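/- Let n be an integer with 1 ≤ n ≤ 200 and let α satisfy 0.0001 < α < 0.27. Let 1 ≤ j ≤ n and suppose real numbers u_j < u_{j+1} < ⋯ < u_n = 1, all in (0,1], satisfy ∫_{u_{i−1}}^{u_i} Σ_{x=i}^n B(n,x,p) dp = (1−α)(u_i − u_{i−1}) for every i = j+1,…,n. Then there exists a unique real number a with 0 < a < u_j such that ∫_{a}^{u_j} Σ_{x=j}^n B(n,x,p) dp = (1−α)(u_j − a). -/

import Mathlib

open MeasureTheory

/-- The binomial probability mass function: `B n x p = C(n,x) p^x (1-p)^(n-x)`. -/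
noncomputable def B (n x : ℕ) (p : ℝ) : ℝ :=
  (n.choose x : ℝ) * p ^ x * (1 - p) ^ (n - x)

/-- The upper tail `P(Y ≥ k)` of a binomial variable `Y` with parameters `n` and `p`. -/
noncomputable def upperTail (n k : ℕ) (p : ℝ) : ℝ :=
  ∑ x ∈ Finset.Icc k n, B n x p

/-- The derivative of `upperTail n k` for `1 ≤ k`: a beta density. -/
noncomputable def tailDensity (n k : ℕ) (p : ℝ) : ℝ :=
  k * (n.choose k : ℝ) * p ^ (k - 1) * (1 - p) ^ (n - k)

lemma upperTail_eq_add {n k : ℕ} (h : k ≤ n) (p : ℝ) :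
    upperTail n k p = B n k p + upperTail n (k + 1) p := by
  unfold upperTail
  rw [← Finset.insert_Icc_add_one_left_eq_Icc h, Finset.sum_insert (by simp)]

lemma B_nonneg (n x : ℕ) {p : ℝ} (h0 : 0 ≤ p) (h1 : p ≤ 1) : 0 ≤ B n x p := by
  have : 0 ≤ 1 - p := by linarith
  unfold B; positivity

lemma sum_range_B (n : ℕ) (p : ℝ) : ∑ x ∈ Finset.range (n + 1), B n x p = 1 := by
  have := add_pow p (1 - p) n
  simp only [add_sub_cancel, one_pow] at this
  rw [this]
  exact Finset.sum_congr rfl fun x _ => by unfold B; ring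

lemma sum_range_add_upperTail {n k : ℕ} (h : k ≤ n + 1) (p : ℝ) :
    ∑ x ∈ Finset.range k, B n x p + upperTail n k p = 1 := by
  rw [← sum_range_B n p, upperTail, ← Finset.sum_range_add_sum_Ico _ h]
  rfl

lemma hasDerivAt_B (n k : ℕ) (hk : k ≤ n) (p : ℝ) :
    HasDerivAt (B n k) (tailDensity n k p - tailDensity n (k + 1) p) p := by
  have hq : HasDerivAt (fun p : ℝ => 1 - p) (-1) p := by
    simpa using (hasDerivAt_id p).const_sub 1
  have h := (((hasDerivAt_id p).pow k).const_mul (n.choose k : ℝ)).mul (hq.pow (n - k))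
  have hc : ((n.choose (k + 1) : ℕ) : ℝ) * (k + 1) = n.choose k * ((n : ℝ) - k) := by
    have := Nat.choose_succ_right_eq n k
    rw [← Nat.cast_sub hk]; exact_mod_cast this
  refine (h.congr_deriv ?_)
  unfold tailDensity
  have e : n - (k + 1) = n - k - 1 := by omega
  rw [e]
  simp only [id, Nat.add_sub_cancel]
  push_cast [Nat.cast_sub hk]
  have : ((k : ℝ) + 1) * (n.choose (k + 1) : ℝ) = n.choose k * ((n : ℝ) - k) := by linarith
  rw [this]; simp only [Pi.pow_apply, id]; ring

lemma hasDerivAt_upperTail {n k : ℕ} (hk : k ≤ n + 1) (p : ℝ) :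
    HasDerivAt (upperTail n k) (tailDensity n k p) p := by
  induction hk using Nat.decreasingInduction with
  | self =>
    have : upperTail n (n + 1) = fun _ => 0 := by
      ext p; simp [upperTail]
    rw [this]; simpa [tailDensity] using hasDerivAt_const p (0 : ℝ)
  | of_succ k hk ih =>
    have hk' : k ≤ n := by omega
    have : upperTail n k = fun p => B n k p + upperTail n (k + 1) p := by
      ext p; exact upperTail_eq_add hk' p
    rw [this]
    exact ((hasDerivAt_B n k hk' p).add ih).congr_deriv (by ring)

lemma continuous_upperTail (n k : ℕ) : Continuous (upperTail n k) := by
  unfold upperTail B; fun_prop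

lemma tailDensity_pos {n k : ℕ} (hk1 : 1 ≤ k) (hkn : k ≤ n) {p : ℝ} (h0 : 0 < p) (h1 : p < 1) :
    0 < tailDensity n k p := by
  have : 0 < 1 - p := by linarith
  have := Nat.choose_pos hkn
  unfold tailDensity; positivity

lemma strictMonoOn_upperTail {n k : ℕ} (hk1 : 1 ≤ k) (hkn : k ≤ n) :
    StrictMonoOn (upperTail n k) (Set.Icc 0 1) := by
  refine strictMonoOn_of_deriv_pos (convex_Icc 0 1) (continuous_upperTail n k).continuousOn ?_
  intro p hp
  rw [interior_Icc] at hp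
  rw [(hasDerivAt_upperTail (by omega) p).deriv]
  exact tailDensity_pos hk1 hkn hp.1 hp.2

lemma upperTail_zero {n k : ℕ} (hk1 : 1 ≤ k) : upperTail n k 0 = 0 := by
  unfold upperTail B
  refine Finset.sum_eq_zero fun x hx => ?_
  have : x ≠ 0 := by have := (Finset.mem_Icc.1 hx).1; omega
  simp [this]

lemma upperTail_one {n k : ℕ} (hkn : k ≤ n) : upperTail n k 1 = 1 := by
  unfold upperTail B
  rw [Finset.sum_eq_single_of_mem n (by simp [hkn])]
  · simp
  · intro x hx hxn
    have : n - x ≠ 0 := by have := (Finset.mem_Icc.1 hx).2; omega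
    simp [this]

/-- An antiderivative of `upperTail n i - β`, vanishing at `0` when `1 ≤ i`. -/
noncomputable def excess (n i : ℕ) (β p : ℝ) : ℝ :=
  (p - i / (n + 1)) * upperTail n i p + i / (n + 1) * (1 - p) * B n i p - β * p

lemma hasDerivAt_excess {n i : ℕ} (hi : i ≤ n) (β p : ℝ) :
    HasDerivAt (excess n i β) (upperTail n i p - β) p := by
  have hN : (n : ℝ) + 1 ≠ 0 := by positivity
  have hq : HasDerivAt (fun p : ℝ => i / ((n : ℝ) + 1) * (1 - p)) (i / ((n : ℝ) + 1) * (-1)) p := by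
    simpa using ((hasDerivAt_id p).const_sub 1).const_mul (i / ((n : ℝ) + 1))
  have h1 := ((hasDerivAt_id p).sub_const ((i : ℝ) / (n + 1))).mul
    (hasDerivAt_upperTail (show i ≤ n + 1 by omega) p)
  have h := (h1.add (hq.mul (hasDerivAt_B n i hi p))).sub ((hasDerivAt_id p).const_mul β)
  refine h.congr_deriv ?_
  have hc : ((n.choose (i + 1) : ℕ) : ℝ) * (i + 1) = n.choose i * ((n : ℝ) - i) := by
    have := Nat.choose_succ_right_eq n i
    rw [← Nat.cast_sub hi]; exact_mod_cast this
  have e1 : (1 - p) * tailDensity n (i + 1) p = (n - i) * B n i p := by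
    unfold tailDensity B
    rcases hi.eq_or_lt with rfl | hlt
    · simp
    · obtain ⟨m, rfl⟩ := Nat.exists_eq_add_of_lt hlt
      have e : i + m + 1 - i = m + 1 := by omega
      have e' : i + m + 1 - (i + 1) = m := by omega
      rw [e, e', pow_succ]
      simp only [Nat.add_sub_cancel]
      push_cast at hc ⊢
      linear_combination p ^ i * (1 - p) ^ m * (1 - p) * hc
  have e2 : p * tailDensity n i p = i * B n i p := by
    unfold tailDensity B
    rcases i with _ | i
    · simp
    · simp only [Nat.add_sub_cancel]; ring
  simp only [id]
  field_simp
  linear_combination (-(i : ℝ)) * e1 + ((n : ℝ) + 1 - i) * e2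

lemma continuous_excess {n i : ℕ} (hi : i ≤ n) (β : ℝ) : Continuous (excess n i β) :=
  continuous_iff_continuousAt.2 fun p => (hasDerivAt_excess hi β p).continuousAt

lemma integral_upperTail {n i : ℕ} (hi : i ≤ n) (β s t : ℝ) :
    (∫ p in s..t, ∑ x ∈ Finset.Icc i n, B n x p) - β * (t - s) =
      excess n i β t - excess n i β s := by
  have hc := continuous_upperTail n i
  have := intervalIntegral.integral_eq_sub_of_hasDerivAt
    (fun p _ => hasDerivAt_excess hi β p)
    ((hc.sub continuous_const).intervalIntegrable s t)
  rw [← this, intervalIntegral.integral_sub (hc.intervalIntegrable s t) (by simp)]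
  simp [upperTail]
  ring

lemma excess_zero {n i : ℕ} (hi : 1 ≤ i) (β : ℝ) : excess n i β 0 = 0 := by
  have : i ≠ 0 := by omega
  simp [excess, upperTail_zero hi, B, this]

/-- The hazard rate `tailDensity / (1 - upperTail)` is monotone (in cross-multiplied form). -/
lemma tailDensity_mul_le {n k : ℕ} (hk : k ≤ n) {x y : ℝ} (hx : 0 ≤ x) (hxy : x ≤ y)
    (hy : y ≤ 1) :
    tailDensity n k x * (1 - upperTail n k y) ≤ tailDensity n k y * (1 - upperTail n k x) := by
  have h1 (p : ℝ) : 1 - upperTail n k p = ∑ i ∈ Finset.range k, B n i p := by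
    linarith [sum_range_add_upperTail (show k ≤ n + 1 by omega) p]
  rw [h1, h1, Finset.mul_sum, Finset.mul_sum]
  refine Finset.sum_le_sum fun i hi => ?_
  have hi : i < k := Finset.mem_range.1 hi
  obtain ⟨d, rfl⟩ := Nat.exists_eq_add_of_lt hi
  obtain ⟨m, rfl⟩ := Nat.exists_eq_add_of_le hk
  have e1 : i + d + 1 + m - i = d + 1 + m := by omega
  have e2 : i + d + 1 + m - (i + d + 1) = m := by omega
  have e3 : i + d + 1 - 1 = i + d := by omega
  unfold tailDensity B
  rw [e1, e2, e3]
  have hx1 : 0 ≤ 1 - x := by linarith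
  have hy1 : 0 ≤ 1 - y := by linarith
  have hy0 : 0 ≤ y := hx.trans hxy
  set K : ℝ := ((i + d + 1 : ℕ) : ℝ) * ((i + d + 1 + m).choose (i + d + 1) : ℝ) *
    ((i + d + 1 + m).choose i : ℝ) * (x ^ i * y ^ i * (1 - x) ^ m * (1 - y) ^ m) with hK
  have hK0 : 0 ≤ K := by positivity
  have key : x ^ d * (1 - y) ^ (d + 1) ≤ y ^ d * (1 - x) ^ (d + 1) := by gcongr
  calc _ = K * (x ^ d * (1 - y) ^ (d + 1)) := by rw [hK]; ring
    _ ≤ K * (y ^ d * (1 - x) ^ (d + 1)) := by gcongr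
    _ = _ := by rw [hK]; ring

lemma upperTail_lt_one {n k : ℕ} (hk1 : 1 ≤ k) (hkn : k ≤ n) {p : ℝ} (h0 : 0 ≤ p) (h1 : p < 1) :
    upperTail n k p < 1 := by
  rw [← upperTail_one hkn]
  exact strictMonoOn_upperTail hk1 hkn ⟨h0, h1.le⟩ ⟨zero_le_one, le_rfl⟩ h1

lemma upperTail_nonneg (n k : ℕ) {p : ℝ} (h0 : 0 ≤ p) (h1 : p ≤ 1) : 0 ≤ upperTail n k p :=
  Finset.sum_nonneg fun x _ => B_nonneg n x h0 h1

/-- A tangent-line bound expressing the log-concavity of `1 - upperTail n k`. -/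
lemma one_sub_upperTail_le_exp {n k : ℕ} (hk1 : 1 ≤ k) (hkn : k ≤ n) {m x : ℝ} (hm0 : 0 < m)
    (hm1 : m < 1) (hx0 : 0 ≤ x) (hx1 : x ≤ 1) :
    1 - upperTail n k x ≤ (1 - upperTail n k m) *
      Real.exp (-(tailDensity n k m / (1 - upperTail n k m)) * (x - m)) := by
  set A := 1 - upperTail n k m with hA
  have hA0 : 0 < A := by linarith [upperTail_lt_one hk1 hkn hm0.le hm1]
  set h := tailDensity n k m / A with hh
  set φ : ℝ → ℝ := fun x => (1 - upperTail n k x) * Real.exp (h * (x - m)) with hφ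
  have hd (y : ℝ) : HasDerivAt φ
      ((h * (1 - upperTail n k y) - tailDensity n k y) * Real.exp (h * (y - m))) y := by
    have h1 := (hasDerivAt_upperTail (show k ≤ n + 1 by omega) y).const_sub 1
    have h2 : HasDerivAt (fun x => Real.exp (h * (x - m))) (Real.exp (h * (y - m)) * h) y := by
      simpa using (((hasDerivAt_id y).sub_const m).const_mul h).exp
    exact (h1.mul h2).congr_deriv (by ring)
  have hc : Continuous φ := continuous_iff_continuousAt.2 fun y => (hd y).continuousAt
  have hmain : φ x ≤ φ m := by
    rcases le_total x m with hxm | hmx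
    · have : MonotoneOn φ (Set.Icc 0 m) := by
        refine monotoneOn_of_deriv_nonneg (convex_Icc 0 m) hc.continuousOn
          (fun y _ => (hd y).differentiableAt.differentiableWithinAt) fun y hy => ?_
        rw [interior_Icc] at hy
        rw [(hd y).deriv]
        refine mul_nonneg ?_ (Real.exp_pos _).le
        have := tailDensity_mul_le hkn hy.1.le hy.2.le hm1.le
        rw [sub_nonneg, hh, div_mul_eq_mul_div, le_div_iff₀ hA0]
        linarith
      exact this ⟨hx0, hxm⟩ ⟨hm0.le, le_rfl⟩ hxm
    · have : AntitoneOn φ (Set.Icc m 1) := by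
        refine antitoneOn_of_deriv_nonpos (convex_Icc m 1) hc.continuousOn
          (fun y _ => (hd y).differentiableAt.differentiableWithinAt) fun y hy => ?_
        rw [interior_Icc] at hy
        rw [(hd y).deriv]
        refine mul_nonpos_of_nonpos_of_nonneg ?_ (Real.exp_pos _).le
        have := tailDensity_mul_le hkn hm0.le hy.1.le hy.2.le
        rw [sub_nonpos, hh, div_mul_eq_mul_div, div_le_iff₀ hA0]
        linarith
      exact this ⟨le_rfl, hm1.le⟩ ⟨hmx, hx1⟩ hmx
  have hφm : φ m = A := by simp [hφ, hA]
  rw [hφm] at hmain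
  rw [neg_mul, Real.exp_neg, ← div_eq_mul_inv, le_div_iff₀ (Real.exp_pos _)]
  exact hmain

/-- Grünbaum's inequality for the order statistic with mean `k / (n + 1)`. -/
lemma exp_neg_one_le_one_sub_upperTail {n k : ℕ} (hk1 : 1 ≤ k) (hkn : k ≤ n) :
    Real.exp (-1) ≤ 1 - upperTail n k (k / (n + 1)) := by
  set m : ℝ := k / (n + 1) with hm
  have hk : (1 : ℝ) ≤ k := by exact_mod_cast hk1
  have hkn' : (k : ℝ) ≤ n := by exact_mod_cast hkn
  have hm0 : 0 < m := by positivity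
  have hm1 : m < 1 := by rw [hm, div_lt_one (by positivity)]; linarith
  set A := 1 - upperTail n k m with hA
  have hA0 : 0 < A := by linarith [upperTail_lt_one hk1 hkn hm0.le hm1]
  have hA1 : A ≤ 1 := by linarith [upperTail_nonneg n k hm0.le hm1.le]
  set h := tailDensity n k m / A with hh
  have hh0 : 0 < h := div_pos (tailDensity_pos hk1 hkn hm0 hm1) hA0
  set x₀ := m + Real.log A / h with hx₀
  have hlog : Real.log A ≤ 0 := Real.log_nonpos hA0.le hA1
  have hx₀m : x₀ ≤ m := by
    have := div_nonpos_of_nonpos_of_nonneg hlog hh0.le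
    linarith
  have hx₀0 : 0 ≤ x₀ := by
    have := one_sub_upperTail_le_exp hk1 hkn hm0 hm1 le_rfl zero_le_one
    rw [upperTail_zero hk1, ← hA, ← hh, ← Real.log_le_log_iff (by norm_num) (by positivity),
      Real.log_mul hA0.ne' (Real.exp_pos _).ne', Real.log_exp] at this
    simp at this
    have e : x₀ * h = h * m + Real.log A := by rw [hx₀]; field_simp
    by_contra hneg
    nlinarith
  set E : ℝ → ℝ := fun x => -excess n k 1 x with hE
  have hdE (y : ℝ) : HasDerivAt E (1 - upperTail n k y) y :=
    (hasDerivAt_excess hkn 1 y).neg.congr_deriv (by ring)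
  have hE0 : E 0 = 0 := by simp [hE, excess_zero hk1]
  have hE1 : E 1 = m := by
    simp only [hE, excess, upperTail_one hkn]; rw [hm]; ring
  have hEx₀ : E x₀ ≤ x₀ := by
    have : AntitoneOn (fun x => E x - x) (Set.Icc 0 1) := by
      have hd (y : ℝ) := (hdE y).sub (hasDerivAt_id y)
      refine antitoneOn_of_deriv_nonpos (convex_Icc 0 1)
        (fun y _ => (hd y).continuousAt.continuousWithinAt)
        (fun y _ => (hd y).differentiableAt.differentiableWithinAt) fun y hy => ?_
      rw [interior_Icc] at hy
      have := (hd y).deriv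
      refine (le_of_eq this).trans ?_
      linarith [upperTail_nonneg n k hy.1.le hy.2.le]
    have := this ⟨le_rfl, zero_le_one⟩ ⟨hx₀0, hx₀m.trans hm1.le⟩ hx₀0
    simp only [hE0] at this
    linarith
  have hanti : AntitoneOn (fun x => E x + A / h * Real.exp (-h * (x - m))) (Set.Icc x₀ 1) := by
    have hd (y : ℝ) : HasDerivAt (fun x => E x + A / h * Real.exp (-h * (x - m)))
        (1 - upperTail n k y - A * Real.exp (-h * (y - m))) y := by
      have h2 : HasDerivAt (fun x => Real.exp (-h * (x - m)))
          (Real.exp (-h * (y - m)) * (-h)) y := by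
        simpa using (((hasDerivAt_id y).sub_const m).const_mul (-h)).exp
      exact ((hdE y).add (h2.const_mul (A / h))).congr_deriv (by field_simp; ring)
    refine antitoneOn_of_deriv_nonpos (convex_Icc x₀ 1)
      (fun y _ => (hd y).continuousAt.continuousWithinAt)
      (fun y _ => (hd y).differentiableAt.differentiableWithinAt) fun y hy => ?_
    rw [interior_Icc] at hy
    rw [(hd y).deriv, sub_nonpos]
    exact one_sub_upperTail_le_exp hk1 hkn hm0 hm1 (hx₀0.trans hy.1.le) hy.2.le
  have h1 := hanti ⟨le_rfl, by linarith⟩ ⟨by linarith, le_rfl⟩ (by linarith : x₀ ≤ 1)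
  have e : A / h * Real.exp (-h * (x₀ - m)) = 1 / h := by
    have : -h * (x₀ - m) = -Real.log A := by rw [hx₀]; field_simp; ring
    rw [this, Real.exp_neg, Real.exp_log hA0]; field_simp
  simp only [e, hE1] at h1
  have h2 : 0 < A / h * Real.exp (-h * (1 - m)) := by positivity
  have h3 : 0 < Real.log A / h + 1 / h := by linarith
  have h4 : -1 < Real.log A := by
    rw [← add_div] at h3
    have := (div_pos_iff_of_pos_right hh0).1 h3
    linarith
  calc Real.exp (-1) ≤ Real.exp (Real.log A) := Real.exp_le_exp.2 h4.le
    _ = A := Real.exp_log hA0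

lemma div_le_of_le_upperTail {n k : ℕ} (hk1 : 1 ≤ k) (hkn : k ≤ n) {p : ℝ} (h0 : 0 ≤ p)
    (h1 : p ≤ 1) (h : 0.64 ≤ upperTail n k p) : (k : ℝ) / (n + 1) ≤ p := by
  by_contra! hlt
  have hm1 : (k : ℝ) / (n + 1) ≤ 1 := by
    have : (k : ℝ) ≤ n := by exact_mod_cast hkn
    rw [div_le_one (by positivity)]; linarith
  have := strictMonoOn_upperTail hk1 hkn ⟨h0, h1⟩ ⟨h0.trans hlt.le, hm1⟩ hlt
  have := exp_neg_one_le_one_sub_upperTail hk1 hkn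
  have := Real.exp_neg_one_gt_d9
  norm_num at *
  linarith

/-- The upper tail, as a function of the success probability, has a differentiable inverse. -/
lemma exists_upperTail_inverse {n k : ℕ} (hk1 : 1 ≤ k) (hkn : k ≤ n) :
    ∃ Q : ℝ → ℝ, ∀ y ∈ Set.Ioo (0 : ℝ) 1, Q y ∈ Set.Ioo (0 : ℝ) 1 ∧ upperTail n k (Q y) = y ∧
      HasDerivAt Q (tailDensity n k (Q y))⁻¹ y := by
  have hmono := strictMonoOn_upperTail hk1 hkn
  have hex (y : ℝ) (hy : y ∈ Set.Ioo (0 : ℝ) 1) :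
      ∃ x ∈ Set.Ioo (0 : ℝ) 1, upperTail n k x = y := by
    have := intermediate_value_Ioo zero_le_one (continuous_upperTail n k).continuousOn
    rw [upperTail_zero hk1, upperTail_one hkn] at this
    exact this hy
  have hex' (y : ℝ) : ∃ x, y ∈ Set.Ioo (0 : ℝ) 1 → x ∈ Set.Ioo (0 : ℝ) 1 ∧ upperTail n k x = y := by
    by_cases hy : y ∈ Set.Ioo (0 : ℝ) 1
    · obtain ⟨x, hx⟩ := hex y hy
      exact ⟨x, fun _ => hx⟩
    · exact ⟨0, fun h => absurd h hy⟩
  choose Q hQ using hex'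
  refine ⟨Q, fun y hy => ⟨(hQ y hy).1, (hQ y hy).2, ?_⟩⟩
  have hQmono : StrictMonoOn Q (Set.Ioo 0 1) := by
    intro s hs t ht hst
    have h1 := hQ s hs
    have h2 := hQ t ht
    rw [← h1.2, ← h2.2] at hst
    exact (hmono.lt_iff_lt (Set.Ioo_subset_Icc_self h1.1) (Set.Ioo_subset_Icc_self h2.1)).1 hst
  have himg : Set.Ioo (0 : ℝ) 1 ⊆ Q '' Set.Ioo 0 1 := by
    intro x hx
    have hx' := Set.Ioo_subset_Icc_self hx
    have hy : upperTail n k x ∈ Set.Ioo (0 : ℝ) 1 := by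
      constructor
      · rw [← upperTail_zero hk1 (n := n)]
        exact hmono ⟨le_rfl, zero_le_one⟩ hx' hx.1
      · exact upperTail_lt_one hk1 hkn hx.1.le hx.2
    exact ⟨_, hy, hmono.injOn (Set.Ioo_subset_Icc_self (hQ _ hy).1) hx' (hQ _ hy).2⟩
  have hcont : ContinuousAt Q y :=
    hQmono.continuousAt_of_image_mem_nhds (Ioo_mem_nhds hy.1 hy.2)
      (Filter.mem_of_superset (Ioo_mem_nhds (hQ y hy).1.1 (hQ y hy).1.2) himg)
  refine HasDerivAt.of_local_left_inverse hcont
    (hasDerivAt_upperTail (show k ≤ n + 1 by omega) (Q y))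
    (tailDensity_pos hk1 hkn (hQ y hy).1.1 (hQ y hy).1.2).ne' ?_
  filter_upwards [Ioo_mem_nhds hy.1 hy.2] with z hz using (hQ z hz).2

/-- Up to a constant factor, `lowerWeight a b` gives the value of `excess (a+b+1) (a+1)` at a
point where `upperTail (a+b+1) (a+2)` is prescribed. -/
noncomputable def lowerWeight (a b : ℕ) (p : ℝ) : ℝ :=
  (b + 1) ^ 2 * p ^ (a + 2) * (1 - p) ^ b

/-- Up to the same constant factor, `upperWeight a b` gives the value of
`excess (a+b+1) (a+1)` at a point where `upperTail (a+b+1) a` is prescribed. -/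
noncomputable def upperWeight (a b : ℕ) (p : ℝ) : ℝ :=
  (a + 1) ^ 2 * p ^ a * (1 - p) ^ (b + 2)

/-- The value of the matched point at which the difference of weights is stationary. -/
noncomputable def critical (a b : ℕ) (p : ℝ) : ℝ :=
  a * ((b + 1) * p - 1) / ((a + 1) * b)

lemma hasDerivAt_pow_mul_pow (k l : ℕ) (p : ℝ) :
    HasDerivAt (fun p : ℝ => p ^ (k + 1) * (1 - p) ^ (l + 1))
      (p ^ k * (1 - p) ^ l * ((k + 1) - (k + l + 2) * p)) p := by
  have hq : HasDerivAt (fun p : ℝ => 1 - p) (-1) p := by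
    simpa using (hasDerivAt_id p).const_sub 1
  refine (((hasDerivAt_id p).pow (k + 1)).mul (hq.pow (l + 1))).congr_deriv ?_
  simp only [id, Nat.add_sub_cancel, Pi.pow_apply]
  push_cast
  ring

lemma hasDerivAt_lowerWeight (a b : ℕ) (hb : 1 ≤ b) (p : ℝ) :
    HasDerivAt (lowerWeight a b)
      ((b + 1) ^ 2 * (p ^ (a + 1) * (1 - p) ^ (b - 1) * ((a + 2) - (a + b + 2) * p))) p := by
  obtain ⟨b, rfl⟩ := Nat.exists_eq_add_of_le' hb
  have := (hasDerivAt_pow_mul_pow (a + 1) b p).const_mul (((b + 1 : ℕ) + 1 : ℝ) ^ 2)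
  convert! this using 1
  · ext x; simp only [lowerWeight]; ring
  · simp only [Nat.add_sub_cancel]; push_cast; ring

lemma hasDerivAt_upperWeight (a b : ℕ) (ha : 1 ≤ a) (p : ℝ) :
    HasDerivAt (upperWeight a b)
      ((a + 1) ^ 2 * (p ^ (a - 1) * (1 - p) ^ (b + 1) * (a - (a + b + 2) * p))) p := by
  obtain ⟨a, rfl⟩ := Nat.exists_eq_add_of_le' ha
  have := (hasDerivAt_pow_mul_pow a (b + 1) p).const_mul (((a + 1 : ℕ) + 1 : ℝ) ^ 2)
  convert! this using 1
  · ext x; simp only [upperWeight]; ring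
  · simp only [Nat.add_sub_cancel]; push_cast; ring

lemma antitoneOn_upperWeight {a b : ℕ} (ha : 1 ≤ a) :
    AntitoneOn (upperWeight a b) (Set.Icc ((a : ℝ) / (a + b + 2)) 1) := by
  have hd (y : ℝ) := hasDerivAt_upperWeight a b ha y
  refine antitoneOn_of_deriv_nonpos (convex_Icc _ 1)
    (fun y _ => (hd y).continuousAt.continuousWithinAt)
    (fun y _ => (hd y).differentiableAt.differentiableWithinAt) fun y hy => ?_
  rw [interior_Icc] at hy
  rw [(hd y).deriv]
  have hy0 : 0 ≤ y := le_trans (by positivity) hy.1.le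
  have hy1 : 0 ≤ 1 - y := by linarith [hy.2]
  have : (a : ℝ) - (a + b + 2) * y ≤ 0 := by
    have := (div_lt_iff₀ (by positivity)).1 hy.1
    linarith
  exact mul_nonpos_of_nonneg_of_nonpos (by positivity)
    (mul_nonpos_of_nonneg_of_nonpos (by positivity) this)

/-- Matching the tails at levels `a` and `a + 2`, the difference of the two weights has a
derivative whose sign is that of `critical a b p - P p`. -/
lemma exists_matching {a b : ℕ} (ha : 1 ≤ a) (hb : 1 ≤ b) :
    ∃ P : ℝ → ℝ, ∃ κ : ℝ → ℝ, ∀ p ∈ Set.Ioo (0 : ℝ) 1, P p ∈ Set.Ioo (0 : ℝ) 1 ∧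
      upperTail (a + b + 1) a (P p) = upperTail (a + b + 1) (a + 2) p ∧ 0 < κ p ∧
      HasDerivAt (fun p => upperWeight a b (P p) - lowerWeight a b p)
        (κ p * (critical a b p - P p)) p := by
  obtain ⟨Q, hQ⟩ := exists_upperTail_inverse (n := a + b + 1) ha (by omega)
  have ha0 : (0 : ℝ) < a := by exact_mod_cast ha
  have hb0 : (0 : ℝ) < b := by exact_mod_cast hb
  refine ⟨fun p => Q (upperTail (a + b + 1) (a + 2) p), fun p => p ^ (a + 1) * (1 - p) ^ (b - 1) *
    ((b + 1) * (a + b + 2) * (a + 1) * b / a), fun p hp => ?_⟩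
  have hp' := Set.Ioo_subset_Icc_self hp
  have hy : upperTail (a + b + 1) (a + 2) p ∈ Set.Ioo (0 : ℝ) 1 := by
    constructor
    · rw [← upperTail_zero (show 1 ≤ a + 2 by omega) (n := a + b + 1)]
      exact strictMonoOn_upperTail (by omega) (by omega) ⟨le_rfl, zero_le_one⟩ hp' hp.1
    · exact upperTail_lt_one (by omega) (by omega) hp.1.le hp.2
  obtain ⟨h1, h2, h3⟩ := hQ _ hy
  have hp1 : 0 < 1 - p := by linarith [hp.2]
  refine ⟨h1, h2, by have := hp.1; positivity, ?_⟩
  have hP := h3.comp p (hasDerivAt_upperTail (show a + 2 ≤ a + b + 1 + 1 by omega) p)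
  have h := ((hasDerivAt_upperWeight a b ha _).comp p hP).sub (hasDerivAt_lowerWeight a b hb p)
  refine h.congr_deriv ?_
  simp only [Function.comp]
  set t := Q (upperTail (a + b + 1) (a + 2) p)
  have hc1 : ((a + b + 1).choose (a + 2) : ℝ) * (a + 2) * (a + 1) =
      ((a + b + 1).choose a : ℝ) * (b + 1) * b := by
    have e1 := Nat.choose_succ_right_eq (a + b + 1) a
    have e2 := Nat.choose_succ_right_eq (a + b + 1) (a + 1)
    rw [show a + b + 1 - a = b + 1 by omega] at e1
    rw [show a + b + 1 - (a + 1) = b by omega] at e2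
    have e1' : ((a + b + 1).choose (a + 1) : ℝ) * (a + 1) = (a + b + 1).choose a * (b + 1) := by
      exact_mod_cast e1
    have e2' : ((a + b + 1).choose (a + 2) : ℝ) * (a + 2) = (a + b + 1).choose (a + 1) * b := by
      exact_mod_cast e2
    linear_combination ((a : ℝ) + 1) * e2' + (b : ℝ) * e1'
  have hC : (0 : ℝ) < (a + b + 1).choose a := by
    exact_mod_cast Nat.choose_pos (show a ≤ a + b + 1 by omega)
  have ht0 : t ≠ 0 := h1.1.ne'
  have ht1 : 1 - t ≠ 0 := by linarith [h1.2]
  have hden : tailDensity (a + b + 1) a t =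
      a * (a + b + 1).choose a * t ^ (a - 1) * (1 - t) ^ (b + 1) := by
    rw [tailDensity, show a + b + 1 - a = b + 1 by omega]
  have hnum : tailDensity (a + b + 1) (a + 2) p =
      (a + 2) * (a + b + 1).choose (a + 2) * p ^ (a + 1) * (1 - p) ^ (b - 1) := by
    rw [tailDensity, show a + b + 1 - (a + 2) = b - 1 by omega]
    push_cast; rfl
  rw [hden, hnum, critical]
  field_simp
  generalize p ^ (a + 1) = s
  linear_combination (s * (a + 1) * (a - t * (a + b + 2))) * hc1

/-- A differentiable function that cannot increase while negative stays below a negative value. -/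
lemma le_of_deriv_nonpos_of_neg {f f' : ℝ → ℝ} {x₀ x₁ : ℝ} (hx : x₀ ≤ x₁)
    (hf : ∀ x ∈ Set.Icc x₀ x₁, HasDerivAt f (f' x) x)
    (hneg : ∀ x ∈ Set.Icc x₀ x₁, f x < 0 → f' x ≤ 0) (h0 : f x₀ < 0) : f x₁ ≤ f x₀ := by
  by_contra! hlt
  have hx' : x₀ < x₁ := lt_of_le_of_ne hx (by rintro rfl; exact lt_irrefl _ hlt)
  obtain ⟨δ, hδ0, hδ⟩ := exists_between (lt_min (sub_pos.2 hlt) (neg_pos.2 h0))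
  rw [lt_min_iff] at hδ
  set ε := δ / (x₁ - x₀) with hε
  have hd : 0 < x₁ - x₀ := sub_pos.2 hx'
  have hε0 : 0 < ε := div_pos hδ0 hd
  have hεδ : ε * (x₁ - x₀) = δ := by rw [hε]; field_simp
  have h := image_le_of_deriv_right_lt_deriv_boundary (f := f) (f' := f') (a := x₀) (b := x₁)
    (fun x hx => (hf x hx).continuousAt.continuousWithinAt)
    (fun x hx => (hf x (Set.Ico_subset_Icc_self hx)).hasDerivWithinAt)
    (B := fun x => f x₀ + ε * (x - x₀)) (B' := fun _ => ε) (by simp)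
    (fun x => by
      simpa using (((hasDerivAt_id x).sub_const x₀).const_mul ε).const_add (f x₀))
    (fun x hx hfx => by
      refine (hneg x (Set.Ico_subset_Icc_self hx) ?_).trans_lt hε0
      rw [hfx]
      have : ε * (x - x₀) ≤ ε * (x₁ - x₀) := by have := hx.2.le; gcongr
      linarith)
    ⟨hx, le_rfl⟩
  simp only [hεδ] at h
  linarith

lemma critical_le_one {a b : ℕ} (hb : 1 ≤ b) {p : ℝ} (hp : p ≤ 1) : critical a b p ≤ 1 := by
  have hb0 : (0 : ℝ) < b := by exact_mod_cast hb
  have ha0 : (0 : ℝ) ≤ a := by positivity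
  rw [critical, div_le_one (by positivity)]
  have : (b + 1) * p - 1 ≤ b := by nlinarith
  nlinarith

lemma div_le_critical {a b : ℕ} (hb : 1 ≤ b) {p : ℝ} (hp : ((a : ℝ) + 2) / (a + b + 2) ≤ p) :
    (a : ℝ) / (a + b + 2) ≤ critical a b p := by
  have hb0 : (0 : ℝ) < b := by exact_mod_cast hb
  have ha0 : (0 : ℝ) ≤ a := by positivity
  rw [div_le_iff₀ (by positivity)] at hp
  rw [critical, div_le_div_iff₀ (by positivity) (by positivity)]
  have : ((a : ℝ) + 1) * b ≤ ((b + 1) * p - 1) * (a + b + 2) := by nlinarith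
  nlinarith

lemma upperWeight_nonneg {a b : ℕ} {p : ℝ} (h0 : 0 ≤ p) (h1 : p ≤ 1) :
    0 ≤ upperWeight a b p := by
  have : 0 ≤ 1 - p := by linarith
  unfold upperWeight; positivity

lemma div_le_matched {a b : ℕ} (ha : 1 ≤ a) {p : ℝ} (h0 : 0 ≤ p) (h1 : p ≤ 1)
    (h : 0.64 ≤ upperTail (a + b + 1) a p) : (a : ℝ) / (a + b + 2) ≤ p := by
  have := div_le_of_le_upperTail ha (by omega) h0 h1 h
  push_cast at this
  rwa [show (a : ℝ) + b + 1 + 1 = a + b + 2 by ring] at this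

/-- If the stationary value of the difference of weights is nonnegative to the right of `p`, then
the difference itself is nonnegative at `p`. -/
lemma lowerWeight_le_of_forall_ge {a b : ℕ} (ha : 1 ≤ a) (hb : 1 ≤ b) {p q : ℝ}
    (hp : p ∈ Set.Ioo (0 : ℝ) 1) (hq : q ∈ Set.Ioo (0 : ℝ) 1)
    (hqp : upperTail (a + b + 1) a q = upperTail (a + b + 1) (a + 2) p)
    (hlow : 0.64 ≤ upperTail (a + b + 1) (a + 2) p)
    (hcrit : ∀ x ∈ Set.Ico p 1, lowerWeight a b x ≤ upperWeight a b (critical a b x)) :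
    lowerWeight a b p ≤ upperWeight a b q := by
  obtain ⟨P, κ, hP⟩ := exists_matching ha hb
  have hPp : P p = q :=
    (strictMonoOn_upperTail (n := a + b + 1) ha (by omega)).injOn
      (Set.Ioo_subset_Icc_self (hP p hp).1) (Set.Ioo_subset_Icc_self hq)
      ((hP p hp).2.1.trans hqp.symm)
  by_contra! hlt
  rw [← hPp] at hlt
  have hbound : ∀ y ∈ Set.Ico p 1,
      -lowerWeight a b y ≤ upperWeight a b (P p) - lowerWeight a b p := by
    intro y hy
    have hIoo : ∀ x ∈ Set.Icc p y, x ∈ Set.Ioo (0 : ℝ) 1 := fun x hx =>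
      ⟨hp.1.trans_le hx.1, hx.2.trans_lt hy.2⟩
    have h := le_of_deriv_nonpos_of_neg hy.1 (fun x hx => (hP x (hIoo x hx)).2.2.2)
      (fun x hx hneg => ?_) (by linarith)
    · have hPy := hP y ⟨hp.1.trans_le hy.1, hy.2⟩
      have := upperWeight_nonneg (a := a) (b := b) hPy.1.1.le hPy.1.2.le
      linarith
    · obtain ⟨h1, h2, h3, -⟩ := hP x (hIoo x hx)
      by_contra! hpos
      have hlt' : P x < critical a b x := by
        by_contra! hge
        exact absurd hpos (not_lt.2 (mul_nonpos_of_nonneg_of_nonpos h3.le (by linarith)))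
      have hx0 := hIoo x hx
      have hmono := (strictMonoOn_upperTail (n := a + b + 1) (k := a + 2) (by omega)
        (by omega)).monotoneOn (Set.Ioo_subset_Icc_self hp) (Set.Ioo_subset_Icc_self hx0) hx.1
      have hge := div_le_matched (b := b) ha h1.1.le h1.2.le (by linarith)
      have hc1 := critical_le_one (a := a) hb hx0.2.le
      have := antitoneOn_upperWeight (b := b) ha ⟨hge, h1.2.le⟩ ⟨hge.trans hlt'.le, hc1⟩ hlt'.le
      have := hcrit x ⟨hx.1, hx0.2⟩
      linarith
  have hcont : Filter.Tendsto (fun y => -lowerWeight a b y) (nhdsWithin 1 (Set.Iio 1))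
      (nhds (-lowerWeight a b 1)) := by
    have : Continuous (lowerWeight a b) := by unfold lowerWeight; fun_prop
    exact (this.neg.tendsto 1).mono_left nhdsWithin_le_nhds
  have h1 : lowerWeight a b 1 = 0 := by
    have : b ≠ 0 := by omega
    simp [lowerWeight, this]
  have := le_of_tendsto hcont (b := upperWeight a b (P p) - lowerWeight a b p)
    (by filter_upwards [Ico_mem_nhdsLT hp.2] with y hy using hbound y hy)
  rw [h1] at this
  linarith

/-- If the stationary value of the difference of weights is nonpositive on `[p₁, p]`, then
positivity of the difference propagates from `p₁` to `p`. -/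
lemma lowerWeight_le_of_forall_le {a b : ℕ} (ha : 1 ≤ a) (hb : 1 ≤ b) {p₁ p q₁ q : ℝ}
    (hp₁ : p₁ ∈ Set.Ioo (0 : ℝ) 1) (hp : p ∈ Set.Ioo (0 : ℝ) 1) (hp₁p : p₁ ≤ p)
    (hq₁ : q₁ ∈ Set.Ioo (0 : ℝ) 1) (hq : q ∈ Set.Ioo (0 : ℝ) 1)
    (hqp₁ : upperTail (a + b + 1) a q₁ = upperTail (a + b + 1) (a + 2) p₁)
    (hqp : upperTail (a + b + 1) a q = upperTail (a + b + 1) (a + 2) p)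
    (hlow : ((a : ℝ) + 2) / (a + b + 2) ≤ p₁)
    (hcrit : ∀ x ∈ Set.Icc p₁ p, upperWeight a b (critical a b x) ≤ lowerWeight a b x)
    (hlt : lowerWeight a b p₁ < upperWeight a b q₁) :
    lowerWeight a b p ≤ upperWeight a b q := by
  obtain ⟨P, κ, hP⟩ := exists_matching ha hb
  have hinj := (strictMonoOn_upperTail (n := a + b + 1) ha (by omega)).injOn
  have hPp : P p = q := hinj (Set.Ioo_subset_Icc_self (hP p hp).1) (Set.Ioo_subset_Icc_self hq)
      ((hP p hp).2.1.trans hqp.symm)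
  have hPp₁ : P p₁ = q₁ :=
    hinj (Set.Ioo_subset_Icc_self (hP p₁ hp₁).1) (Set.Ioo_subset_Icc_self hq₁)
      ((hP p₁ hp₁).2.1.trans hqp₁.symm)
  rw [← hPp₁] at hlt
  rw [← hPp]
  have hIoo : ∀ x ∈ Set.Icc p₁ p, x ∈ Set.Ioo (0 : ℝ) 1 := fun x hx =>
    ⟨hp₁.1.trans_le hx.1, hx.2.trans_lt hp.2⟩
  have h := le_of_deriv_nonpos_of_neg hp₁p
    (fun x hx => (hP x (hIoo x hx)).2.2.2.neg) (fun x hx hneg => ?_)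
    (by simp only [Pi.neg_apply]; linarith)
  · simp only [Pi.neg_apply] at h
    linarith
  · obtain ⟨h1, h2, h3, -⟩ := hP x (hIoo x hx)
    simp only [Pi.neg_apply] at hneg
    by_contra! hpos
    have hlt' : critical a b x < P x := by
      by_contra! hge
      have := mul_nonneg h3.le (sub_nonneg.2 hge)
      linarith
    have hge := div_le_critical (a := a) hb (hlow.trans hx.1)
    have := antitoneOn_upperWeight (b := b) ha ⟨hge, hlt'.le.trans h1.2.le⟩
      ⟨hge.trans hlt'.le, h1.2.le⟩ hlt'.le
    have := hcrit x hx
    linarith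

/-- The logarithm of `upperWeight a b (critical a b p) / lowerWeight a b p`. -/
noncomputable def logRatio (a b : ℕ) (p : ℝ) : ℝ :=
  2 * Real.log (a + 1) + a * Real.log (critical a b p) + (b + 2) * Real.log (1 - critical a b p)
    - 2 * Real.log (b + 1) - (a + 2) * Real.log p - b * Real.log (1 - p)

lemma critical_mem_Ioo {a b : ℕ} (ha : 1 ≤ a) (hb : 1 ≤ b) {p : ℝ}
    (hp : ((a : ℝ) + 2) / (a + b + 2) ≤ p) (hp1 : p < 1) : critical a b p ∈ Set.Ioo (0 : ℝ) 1 := by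
  have hb0 : (0 : ℝ) < b := by exact_mod_cast hb
  have ha0 : (0 : ℝ) < a := by exact_mod_cast ha
  refine ⟨lt_of_lt_of_le (by positivity) (div_le_critical hb hp), ?_⟩
  rw [critical, div_lt_one (by positivity)]
  have : (b + 1) * p - 1 < b := by nlinarith
  nlinarith

lemma logRatio_eq {a b : ℕ} (ha : 1 ≤ a) (hb : 1 ≤ b) {p : ℝ}
    (hp : ((a : ℝ) + 2) / (a + b + 2) ≤ p) (hp1 : p < 1) :
    logRatio a b p =
      Real.log (upperWeight a b (critical a b p)) - Real.log (lowerWeight a b p) := by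
  obtain ⟨hc0, hc1⟩ := critical_mem_Ioo ha hb hp hp1
  have hp0 : 0 < p := lt_of_lt_of_le (by positivity) hp
  have h1 : 0 < 1 - p := by linarith
  have h2 : 0 < 1 - critical a b p := by linarith
  have ha1 : (0 : ℝ) < a + 1 := by positivity
  have hb1 : (0 : ℝ) < b + 1 := by positivity
  rw [upperWeight, lowerWeight, Real.log_mul (by positivity) (by positivity),
    Real.log_mul (by positivity) (by positivity), Real.log_mul (by positivity) (by positivity),
    Real.log_mul (by positivity) (by positivity)]
  simp only [Real.log_pow, logRatio]
  push_cast
  ring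

lemma logRatio_nonneg_iff {a b : ℕ} (ha : 1 ≤ a) (hb : 1 ≤ b) {p : ℝ}
    (hp : ((a : ℝ) + 2) / (a + b + 2) ≤ p) (hp1 : p < 1) :
    0 ≤ logRatio a b p ↔ lowerWeight a b p ≤ upperWeight a b (critical a b p) := by
  obtain ⟨hc0, hc1⟩ := critical_mem_Ioo ha hb hp hp1
  have hp0 : 0 < p := lt_of_lt_of_le (by positivity) hp
  have h1 : 0 < 1 - p := by linarith
  have h2 : 0 < 1 - critical a b p := by linarith
  rw [logRatio_eq ha hb hp hp1, sub_nonneg, Real.log_le_log_iff]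
  · unfold lowerWeight; positivity
  · unfold upperWeight; positivity

lemma logRatio_nonpos_iff {a b : ℕ} (ha : 1 ≤ a) (hb : 1 ≤ b) {p : ℝ}
    (hp : ((a : ℝ) + 2) / (a + b + 2) ≤ p) (hp1 : p < 1) :
    logRatio a b p ≤ 0 ↔ upperWeight a b (critical a b p) ≤ lowerWeight a b p := by
  obtain ⟨hc0, hc1⟩ := critical_mem_Ioo ha hb hp hp1
  have hp0 : 0 < p := lt_of_lt_of_le (by positivity) hp
  have h1 : 0 < 1 - p := by linarith
  have h2 : 0 < 1 - critical a b p := by linarith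
  rw [logRatio_eq ha hb hp hp1, sub_nonpos, Real.log_le_log_iff]
  · unfold upperWeight; positivity
  · unfold lowerWeight; positivity

/-- The second zero of the derivative of `logRatio`. -/
noncomputable def turningPoint (a b : ℕ) : ℝ := 1 - b ^ 2 / ((b + 1) * (a + b))

lemma hasDerivAt_logRatio {a b : ℕ} (ha : 1 ≤ a) (hb : 1 ≤ b) {p : ℝ}
    (hp : ((a : ℝ) + 2) / (a + b + 2) ≤ p) (hp1 : p < 1) :
    ∃ κ : ℝ, 0 < κ ∧ HasDerivAt (logRatio a b)
      (κ * ((p - (a + 2) / (a + b + 2)) * (p - turningPoint a b))) p := by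
  have hb0 : (0 : ℝ) < b := by exact_mod_cast hb
  have ha0 : (0 : ℝ) < a := by exact_mod_cast ha
  obtain ⟨hc0, hc1⟩ := critical_mem_Ioo ha hb hp hp1
  have hp0 : 0 < p := lt_of_lt_of_le (by positivity) hp
  have hv : 0 < 1 - p := by linarith
  have hw : 0 < 1 - critical a b p := by linarith
  have hnum : 0 < (b + 1) * p - 1 := by
    rw [critical] at hc0
    have := (div_pos_iff_of_pos_right (by positivity : (0 : ℝ) < (a + 1) * b)).1 hc0
    exact (pos_iff_pos_of_mul_pos this).1 ha0
  have hcd : HasDerivAt (critical a b) (a * (b + 1) / ((a + 1) * b)) p := by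
    have := (((((hasDerivAt_id p).const_mul ((b : ℝ) + 1)).sub_const 1).const_mul (a : ℝ)).div_const
      (((a : ℝ) + 1) * b))
    refine this.congr_deriv ?_
    simp
  have hone : HasDerivAt (fun p : ℝ => 1 - p) (-1) p := by
    simpa using (hasDerivAt_id p).const_sub 1
  have hd := ((((((hcd.log hc0.ne').const_mul (a : ℝ)).const_add (2 * Real.log ((a : ℝ) + 1))).add
    (((hcd.const_sub 1).log hw.ne').const_mul ((b : ℝ) + 2))).sub_const
      (2 * Real.log ((b : ℝ) + 1))).sub
        (((hasDerivAt_id p).log hp0.ne').const_mul ((a : ℝ) + 2))).sub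
          ((hone.log hv.ne').const_mul (b : ℝ))
  have hw' : 1 - critical a b p = (b + a * (b + 1) * (1 - p)) / ((a + 1) * b) := by
    rw [critical]; field_simp; ring
  have hwn : 0 < (b : ℝ) + a * (b + 1) * (1 - p) := by positivity
  refine ⟨(b + 1) * (a + b) * (a + b + 2) /
    (p * ((b + 1) * p - 1) * (1 - p) * (b + a * (b + 1) * (1 - p))), by positivity, ?_⟩
  refine hd.congr_deriv ?_
  rw [hw', critical, turningPoint]
  simp only [id]
  have e1 := hnum.ne'
  have e2 := hwn.ne'
  have e3 := hv.ne'
  field_simp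
  ring

lemma monotoneOn_logRatio {a b : ℕ} (ha : 1 ≤ a) (hb : 1 ≤ b) :
    MonotoneOn (logRatio a b)
      (Set.Ico (max (((a : ℝ) + 2) / (a + b + 2)) (turningPoint a b)) 1) := by
  refine monotoneOn_of_deriv_nonneg (convex_Ico _ 1) (fun y hy => ?_) (fun y hy => ?_)
    fun y hy => ?_
  · obtain ⟨κ, -, h⟩ := hasDerivAt_logRatio ha hb ((le_max_left _ _).trans hy.1) hy.2
    exact h.continuousAt.continuousWithinAt
  · rw [interior_Ico] at hy
    obtain ⟨κ, -, h⟩ := hasDerivAt_logRatio ha hb ((le_max_left _ _).trans hy.1.le) hy.2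
    exact h.differentiableAt.differentiableWithinAt
  · rw [interior_Ico] at hy
    obtain ⟨κ, hκ, h⟩ := hasDerivAt_logRatio ha hb ((le_max_left _ _).trans hy.1.le) hy.2
    rw [h.deriv]
    obtain ⟨h1, h2⟩ := max_lt_iff.1 hy.1
    exact mul_nonneg hκ.le (mul_nonneg (by linarith) (by linarith))

lemma antitoneOn_logRatio {a b : ℕ} (ha : 1 ≤ a) (hb : 1 ≤ b) :
    AntitoneOn (logRatio a b) (Set.Icc (((a : ℝ) + 2) / (a + b + 2)) (turningPoint a b)) := by
  have hb0 : (0 : ℝ) < b := by exact_mod_cast hb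
  have ht : turningPoint a b < 1 := by
    have : (0 : ℝ) < b ^ 2 / ((b + 1) * (a + b)) := by positivity
    unfold turningPoint; linarith
  refine antitoneOn_of_deriv_nonpos (convex_Icc _ _) (fun y hy => ?_) (fun y hy => ?_)
    fun y hy => ?_
  · obtain ⟨κ, -, h⟩ := hasDerivAt_logRatio ha hb hy.1 (hy.2.trans_lt ht)
    exact h.continuousAt.continuousWithinAt
  · rw [interior_Icc] at hy
    obtain ⟨κ, -, h⟩ := hasDerivAt_logRatio ha hb hy.1.le (hy.2.trans ht)
    exact h.differentiableAt.differentiableWithinAt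
  · rw [interior_Icc] at hy
    obtain ⟨κ, hκ, h⟩ := hasDerivAt_logRatio ha hb hy.1.le (hy.2.trans ht)
    rw [h.deriv]
    refine mul_nonpos_of_nonneg_of_nonpos hκ.le ?_
    exact mul_nonpos_of_nonneg_of_nonpos (by linarith [hy.1]) (by linarith [hy.2])

lemma monotoneOn_logProfile :
    MonotoneOn (fun t : ℝ => (t + 2) * Real.log (t + 2) - 2 * Real.log (t + 1) - t * Real.log t)
      (Set.Ici 1) := by
  have hd (t : ℝ) (ht : 0 < t) : HasDerivAt
      (fun t : ℝ => (t + 2) * Real.log (t + 2) - 2 * Real.log (t + 1) - t * Real.log t)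
      (Real.log (1 + 2 / t) - 2 / (t + 1)) t := by
    have h2 := (hasDerivAt_id t).add_const 2
    have h1 := (hasDerivAt_id t).add_const 1
    have h := ((h2.mul (h2.log (by simp; positivity))).sub
      ((h1.log (by simp; positivity)).const_mul 2)).sub
        ((hasDerivAt_id t).mul ((hasDerivAt_id t).log ht.ne'))
    refine h.congr_deriv ?_
    have e : 1 + 2 / t = (t + 2) / t := by field_simp
    rw [e, Real.log_div (by positivity) ht.ne']
    simp only [id]
    field_simp
    ring
  refine monotoneOn_of_deriv_nonneg (convex_Ici 1)
    (fun y hy => (hd y (by have : (1 : ℝ) ≤ y := hy; linarith)).continuousAt.continuousWithinAt)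
    (fun y hy => ?_) fun y hy => ?_
  · rw [interior_Ici] at hy
    have : (1 : ℝ) < y := hy
    exact (hd y (by linarith)).differentiableAt.differentiableWithinAt
  · rw [interior_Ici] at hy
    have hy : (1 : ℝ) < y := hy
    have hy0 : 0 < y := by linarith
    rw [(hd y hy0).deriv]
    have := Real.le_log_one_add_of_nonneg (show 0 ≤ 2 / y by positivity)
    have e : 2 * (2 / y) / (2 / y + 2) = 2 / (y + 1) := by field_simp; ring
    linarith

lemma logRatio_mode {a b : ℕ} (ha : 1 ≤ a) (hb : 1 ≤ b) :
    logRatio a b (((a : ℝ) + 2) / (a + b + 2)) =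
      (((b : ℝ) + 2) * Real.log (b + 2) - 2 * Real.log (b + 1) - b * Real.log b) -
      (((a : ℝ) + 2) * Real.log (a + 2) - 2 * Real.log (a + 1) - a * Real.log a) := by
  have hb0 : (0 : ℝ) < b := by exact_mod_cast hb
  have ha0 : (0 : ℝ) < a := by exact_mod_cast ha
  have hc : critical a b (((a : ℝ) + 2) / (a + b + 2)) = a / (a + b + 2) := by
    rw [critical]; field_simp; ring
  have h1 : 1 - (a : ℝ) / (a + b + 2) = (b + 2) / (a + b + 2) := by field_simp; ring
  have h2 : 1 - ((a : ℝ) + 2) / (a + b + 2) = b / (a + b + 2) := by field_simp; ring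
  rw [logRatio, hc, h1, h2, Real.log_div (by positivity) (by positivity),
    Real.log_div (by positivity) (by positivity), Real.log_div (by positivity) (by positivity),
    Real.log_div (by positivity) (by positivity)]
  ring

lemma logRatio_mode_nonneg {a b : ℕ} (ha : 1 ≤ a) (hab : a ≤ b) :
    0 ≤ logRatio a b (((a : ℝ) + 2) / (a + b + 2)) := by
  rw [logRatio_mode ha (ha.trans hab), sub_nonneg]
  exact monotoneOn_logProfile (Set.mem_Ici.2 (by exact_mod_cast ha))
    (Set.mem_Ici.2 (by exact_mod_cast ha.trans hab)) (by exact_mod_cast hab)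

lemma logRatio_mode_nonpos {a b : ℕ} (hb : 1 ≤ b) (hab : b ≤ a) :
    logRatio a b (((a : ℝ) + 2) / (a + b + 2)) ≤ 0 := by
  rw [logRatio_mode (hb.trans hab) hb, sub_nonpos]
  exact monotoneOn_logProfile (Set.mem_Ici.2 (by exact_mod_cast hb))
    (Set.mem_Ici.2 (by exact_mod_cast hb.trans hab)) (by exact_mod_cast hab)

lemma mode_le_of_le_upperTail {a b : ℕ} (hb : 1 ≤ b) {p : ℝ} (hp : p ∈ Set.Ioo (0 : ℝ) 1)
    (h : 0.64 ≤ upperTail (a + b + 1) (a + 2) p) : ((a : ℝ) + 2) / (a + b + 2) ≤ p := by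
  have := div_le_of_le_upperTail (n := a + b + 1) (k := a + 2) (by omega) (by omega) hp.1.le
    hp.2.le h
  push_cast at this
  rwa [show (a : ℝ) + b + 1 + 1 = a + b + 2 by ring] at this

lemma le_of_upperTail_le {n k : ℕ} (hk1 : 1 ≤ k) (hkn : k ≤ n) {p q : ℝ}
    (hp : p ∈ Set.Ioo (0 : ℝ) 1) (hq : q ∈ Set.Ioo (0 : ℝ) 1)
    (h : upperTail n k p ≤ upperTail n k q) : p ≤ q :=
  ((strictMonoOn_upperTail hk1 hkn).le_iff_le (Set.Ioo_subset_Icc_self hp)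
    (Set.Ioo_subset_Icc_self hq)).1 h

lemma lowerWeight_le_of_logRatio_nonneg {a b : ℕ} (ha : 1 ≤ a) (hb : 1 ≤ b) {p q : ℝ}
    (hp : p ∈ Set.Ioo (0 : ℝ) 1) (hq : q ∈ Set.Ioo (0 : ℝ) 1)
    (hqp : upperTail (a + b + 1) a q = upperTail (a + b + 1) (a + 2) p)
    (hlow : 0.64 ≤ upperTail (a + b + 1) (a + 2) p) {p₁ : ℝ} (hp₁ : p₁ ≤ p)
    (hmode : ((a : ℝ) + 2) / (a + b + 2) ≤ p₁) (hturn : turningPoint a b ≤ p₁)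
    (hratio : 0 ≤ logRatio a b p₁) :
    lowerWeight a b p ≤ upperWeight a b q := by
  refine lowerWeight_le_of_forall_ge ha hb hp hq hqp hlow fun x hx => ?_
  have h1 : p₁ ≤ x := hp₁.trans hx.1
  rw [← logRatio_nonneg_iff ha hb (hmode.trans h1) hx.2]
  exact hratio.trans (monotoneOn_logRatio ha hb ⟨max_le hmode hturn, h1.trans_lt hx.2⟩
    ⟨max_le (hmode.trans h1) (hturn.trans h1), hx.2⟩ h1)

lemma lowerWeight_le_of_le {a b : ℕ} (ha : 1 ≤ a) (hab : a ≤ b) {p q : ℝ}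
    (hp : p ∈ Set.Ioo (0 : ℝ) 1) (hq : q ∈ Set.Ioo (0 : ℝ) 1)
    (hqp : upperTail (a + b + 1) a q = upperTail (a + b + 1) (a + 2) p)
    (hlow : 0.64 ≤ upperTail (a + b + 1) (a + 2) p) :
    lowerWeight a b p ≤ upperWeight a b q := by
  have hb : 1 ≤ b := ha.trans hab
  refine lowerWeight_le_of_logRatio_nonneg ha hb hp hq hqp hlow
    (mode_le_of_le_upperTail hb hp hlow) le_rfl ?_ (logRatio_mode_nonneg ha hab)
  have hb0 : (0 : ℝ) < b := by exact_mod_cast hb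
  have ha0 : (0 : ℝ) < a := by exact_mod_cast ha
  have hab' : (a : ℝ) ≤ b := by exact_mod_cast hab
  have e : ((a : ℝ) + 2) / (a + b + 2) = 1 - b / (a + b + 2) := by field_simp; ring
  rw [turningPoint, e, sub_le_sub_iff_left, div_le_div_iff₀ (by positivity) (by positivity)]
  nlinarith

/-- The comparison of weights for `b ≤ a`, deduced from a strict comparison at a test point. -/
lemma lowerWeight_le_of_test {a b : ℕ} (hb : 1 ≤ b) (hab : b ≤ a) {p q : ℝ}
    (hp : p ∈ Set.Ioo (0 : ℝ) 1) (hq : q ∈ Set.Ioo (0 : ℝ) 1)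
    (hqp : upperTail (a + b + 1) a q = upperTail (a + b + 1) (a + 2) p)
    {p₁ r₁ : ℝ} (hp₁ : p₁ ∈ Set.Ioo (0 : ℝ) 1) (hr₁ : r₁ ∈ Set.Ioo (0 : ℝ) 1)
    (hlow : 0.64 ≤ upperTail (a + b + 1) (a + 2) p₁)
    (hle : upperTail (a + b + 1) (a + 2) p₁ ≤ upperTail (a + b + 1) (a + 2) p)
    (hr : upperTail (a + b + 1) (a + 2) p₁ ≤ upperTail (a + b + 1) a r₁)
    (hlt : lowerWeight a b p₁ < upperWeight a b r₁) :
    lowerWeight a b p ≤ upperWeight a b q := by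
  have ha : 1 ≤ a := hb.trans hab
  have hmode := mode_le_of_le_upperTail hb hp₁ hlow
  have hp₁p := le_of_upperTail_le (by omega) (by omega) hp₁ hp hle
  by_cases hcase : turningPoint a b ≤ p ∧ 0 ≤ logRatio a b p
  · exact lowerWeight_le_of_logRatio_nonneg ha hb hp hq hqp (hlow.trans hle) le_rfl
      (hmode.trans hp₁p) hcase.1 hcase.2
  obtain ⟨P, κ, hP⟩ := exists_matching ha hb
  obtain ⟨hq₁, hqp₁, -⟩ := hP p₁ hp₁
  refine lowerWeight_le_of_forall_le ha hb hp₁ hp hp₁p hq₁ hq hqp₁ hqp hmode (fun x hx => ?_) ?_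
  · have hx1 : x < 1 := hx.2.trans_lt hp.2
    have hxm := hmode.trans hx.1
    rw [← logRatio_nonpos_iff ha hb hxm hx1]
    rcases le_total x (turningPoint a b) with hxt | htx
    · exact (antitoneOn_logRatio ha hb ⟨le_rfl, hxm.trans hxt⟩ ⟨hxm, hxt⟩ hxm).trans
        (logRatio_mode_nonpos hb hab)
    · have hpt := htx.trans hx.2
      have hneg : logRatio a b p < 0 := by
        by_contra! h
        exact hcase ⟨hpt, h⟩
      exact (monotoneOn_logRatio ha hb ⟨max_le hxm htx, hx1⟩
        ⟨max_le (hxm.trans hx.2) hpt, hp.2⟩ hx.2).trans hneg.le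
  · refine hlt.trans_le (antitoneOn_upperWeight ha ⟨?_, hq₁.2.le⟩ ⟨?_, hr₁.2.le⟩ ?_)
    · exact div_le_matched ha hq₁.1.le hq₁.2.le (hqp₁ ▸ hlow)
    · exact div_le_matched ha hr₁.1.le hr₁.2.le (hlow.trans hr)
    · exact le_of_upperTail_le ha (by omega) hq₁ hr₁ (hqp₁ ▸ hr)

/-- `f t`, arranged so that the kernel evaluates `t` before substituting it. -/
def withValue {α : Type} (t : ℕ) (f : ℕ → α) : α :=
  Nat.rec (f 0) (fun m _ => f (Nat.succ m)) t

lemma withValue_eq {α : Type} (t : ℕ) (f : ℕ → α) : withValue t f = f t := by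
  cases t <;> rfl

/-- If `t = C(n,k) X^k Y^(n-k)`, this is `s` plus the sum of `C(n,i) X^i Y^(n-i)` over the `f`
indices `i` starting from `k`. -/
def addTerms (n X Y f : ℕ) : ℕ → ℕ → ℕ → ℕ :=
  Nat.rec (fun _ _ s => s)
    (fun _ ih k t s => Nat.rec s
      (fun t' _ => ih (Nat.succ k)
        (Nat.div (Nat.mul (Nat.mul (Nat.succ t') (Nat.sub n k)) X) (Nat.mul (Nat.succ k) Y))
        (Nat.add s (Nat.succ t'))) t) f

lemma addTerms_succ (n X Y f k t s : ℕ) (ht : t ≠ 0) :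
    addTerms n X Y (f + 1) k t s =
      addTerms n X Y f (k + 1) (t * (n - k) * X / ((k + 1) * Y)) (s + t) := by
  obtain ⟨t, rfl⟩ := Nat.exists_eq_succ_of_ne_zero ht
  rfl

lemma addTerms_eq {n X Y : ℕ} (hX : 0 < X) (hY : 0 < Y) (f k t s : ℕ) (hf : k + f ≤ n + 1)
    (ht : k ≤ n → t = n.choose k * X ^ k * Y ^ (n - k)) :
    addTerms n X Y f k t s =
      s + ∑ i ∈ Finset.range f, n.choose (k + i) * X ^ (k + i) * Y ^ (n - (k + i)) := by
  induction f generalizing k t s with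
  | zero => simp [addTerms]
  | succ f ih =>
    have hk : k ≤ n := by omega
    have ht := ht hk
    have ht0 : t ≠ 0 := by
      have := Nat.choose_pos hk
      rw [ht]; positivity
    rw [addTerms_succ n X Y f k t s ht0, ih (k + 1) _ _ (by omega), Finset.sum_range_succ', ht]
    · simp only [Nat.add_zero, add_assoc, add_comm 1]
      ring
    · intro hk1
      rw [ht]
      refine Nat.div_eq_of_eq_mul_left (by positivity) ?_
      have h1 := Nat.choose_succ_right_eq n k
      have h2 : n - k = (n - (k + 1)) + 1 := by omega
      have h3 : Y ^ (n - k) = Y ^ (n - (k + 1)) * Y := by rw [← pow_succ, ← h2]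
      rw [h3, pow_succ]
      calc _ = (n.choose k * (n - k)) * (X ^ k * X * Y ^ (n - (k + 1)) * Y) := by ring
        _ = _ := by rw [← h1]; ring

lemma upperTail_mul_pow {n X Y M : ℕ} (hM : 0 < M) (hXY : X + Y = M) (k : ℕ) (hk : k ≤ n + 1) :
    upperTail n (n + 1 - k) (Y / M : ℝ) * M ^ n =
      ((∑ i ∈ Finset.range k, n.choose i * X ^ i * Y ^ (n - i) : ℕ) : ℝ) := by
  have hM' : (M : ℝ) ≠ 0 := by positivity
  induction k with
  | zero => simp [upperTail]
  | succ k ih =>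
    have e : n + 1 - (k + 1) = n - k := by omega
    have e' : n + 1 - k = n - k + 1 := by omega
    have e2 : n - (n - k) = k := by omega
    have e3 : (1 : ℝ) - Y / M = X / M := by
      rw [← hXY] at hM' ⊢; push_cast at hM' ⊢; field_simp; ring
    have e4 : (M : ℝ) ^ n = M ^ k * M ^ (n - k) := by rw [← pow_add]; congr 1; omega
    rw [e, upperTail_eq_add (by omega), add_mul, ← e', ih (by omega), Finset.sum_range_succ, B,
      e2, e3, Nat.choose_symm (by omega : k ≤ n), e4]
    have h1 : (M : ℝ) ^ k ≠ 0 := by positivity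
    have h2 : (M : ℝ) ^ (n - k) ≠ 0 := by positivity
    push_cast
    rw [div_pow, div_pow]
    generalize (M : ℝ) ^ k = u at *
    generalize (M : ℝ) ^ (n - k) = w at *
    field_simp
    ring

lemma upperTail_eq_addTerms {n X Y M : ℕ} (hX : 0 < X) (hY : 0 < Y) (hXY : X + Y = M) {k : ℕ}
    (hk : k ≤ n + 1) :
    upperTail n (n + 1 - k) (Y / M : ℝ) = (addTerms n X Y k 0 (Nat.pow Y n) 0 : ℝ) / M ^ n := by
  have hM : 0 < M := by omega
  rw [addTerms_eq hX hY k 0 _ 0 (by omega) (by simp), eq_div_iff (by positivity),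
    upperTail_mul_pow hM hXY k hk]
  simp

/-- One thousand times the distance of the test point for `(a, b)` from `b`, in units of
`1 / (a + b + 2)`. -/
def testShift (b : ℕ) : ℕ :=
  if b ≤ 1 then 600 else if b ≤ 2 then 770 else if b ≤ 3 then 890 else if b ≤ 4 then 1000
  else if b ≤ 5 then 1075 else if b ≤ 6 then 1175 else if b ≤ 20 then 890 + 50 * b
  else 1400 + 25 * b

/-- One thousand times the distance of the matched test point for `(a, b)` from `b + 2`, in units
of `1 / (a + b + 2)`. -/
def matchedShift (a b : ℕ) : ℕ :=
  a * ((b + 1) * testShift b - (if b ≤ 1 then 200 else 250)) / ((a + 1) * b)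

/-- The test of the sign of `logRatio a b` at `Y / M`. -/
def ratioTest (a b M X Y : ℕ) : Bool :=
  Nat.ble (X * ((b + 1) * (a + b))) (b * b * M) &&
  Nat.ble
    (Nat.mul (Nat.mul (Nat.mul (Nat.pow (b + 1) 2) (Nat.pow (b * (a + 1)) (a + b + 2)))
      (Nat.pow Y (a + 2))) (Nat.pow X b))
    (Nat.mul (Nat.mul (Nat.mul (Nat.pow (a + 1) 2) (Nat.pow a a))
      (Nat.pow ((b + 1) * Y - M) a)) (Nat.pow (b * M + a * (b + 1) * X) (b + 2)))

/-- The test of the comparison of weights at `Y / M`, where `S / T` is the tail there. -/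
def weightTest (a b M X Y T S : ℕ) : Bool :=
  withValue (1000 * (b + 2) - matchedShift a b) fun X' => withValue (M - X') fun Y' =>
  Nat.ble 1 X' && Nat.ble 1 Y' && Nat.ble (64 * T) (100 * S) &&
  Nat.ble S (addTerms (a + b + 1) X' Y' (b + 2) 0 (Nat.pow Y' (a + b + 1)) 0) &&
  Nat.ble
    (Nat.succ (Nat.mul (Nat.mul (Nat.pow (b + 1) 2) (Nat.pow Y (a + 2))) (Nat.pow X b)))
    (Nat.mul (Nat.mul (Nat.pow (a + 1) 2) (Nat.pow Y' a)) (Nat.pow X' (b + 2)))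

/-- The full test for the pair `(a, b)`. -/
def pairTest (a b : ℕ) : Bool :=
  withValue (1000 * b - testShift b) fun X => withValue (1000 * (a + b + 2)) fun M =>
  withValue (M - X) fun Y => withValue (Nat.pow M (a + b + 1)) fun T =>
  withValue (addTerms (a + b + 1) X Y b 0 (Nat.pow Y (a + b + 1)) 0) fun S =>
  Nat.ble 1 X && Nat.ble 1 Y && Nat.ble X (1000 * b) && Nat.ble (100 * S) (73 * T) &&
  (ratioTest a b M X Y || weightTest a b M X Y T S)

/-- The conjunction of the tests for the pairs `(b + 1 + k, b)` with `k < m`. -/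
def rowTest (b m : ℕ) : Bool :=
  Nat.rec true (fun k ih => withValue (b + 1 + k) fun a => pairTest a b && ih) m

lemma pairTest_of_rowTest {b m : ℕ} (h : rowTest b m = true) {a : ℕ} (hab : b < a)
    (ham : a < b + 1 + m) : pairTest a b = true := by
  induction m with
  | zero => omega
  | succ m ih =>
    have hs : rowTest b (m + 1) = (pairTest (b + 1 + m) b && rowTest b m) :=
      withValue_eq (b + 1 + m) fun a => pairTest a b && rowTest b m
    rw [hs, Bool.and_eq_true] at h
    rcases (show a ≤ b + 1 + m by omega |>.eq_or_lt) with rfl | hlt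
    · exact h.1
    · exact ih h.2 hlt

set_option maxHeartbeats 0 in
set_option maxRecDepth 100000 in
lemma rowTest_eq_true {b : ℕ} (h1 : 1 ≤ b) (h2 : b ≤ 99) : rowTest b (199 - 2 * b) = true := by
  interval_cases b <;> decide +kernel

lemma lowerWeight_div {a b : ℕ} {X Y M : ℕ} (hM : 0 < M) (hXY : X + Y = M) :
    lowerWeight a b (Y / M : ℝ) =
      ((b + 1 : ℝ) ^ 2 * Y ^ (a + 2) * X ^ b) / M ^ (a + b + 2) := by
  have e : (1 : ℝ) - Y / M = X / M := by
    have : (M : ℝ) ≠ 0 := by positivity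
    rw [← hXY] at this ⊢; push_cast at this ⊢; field_simp; ring
  rw [lowerWeight, e, div_pow, div_pow, show a + b + 2 = (a + 2) + b by ring, pow_add _ (a + 2) b]
  ring

lemma upperWeight_div {a b : ℕ} {X Y M : ℕ} (hM : 0 < M) (hXY : X + Y = M) :
    upperWeight a b (Y / M : ℝ) =
      ((a + 1 : ℝ) ^ 2 * Y ^ a * X ^ (b + 2)) / M ^ (a + b + 2) := by
  have e : (1 : ℝ) - Y / M = X / M := by
    have : (M : ℝ) ≠ 0 := by positivity
    rw [← hXY] at this ⊢; push_cast at this ⊢; field_simp; ring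
  rw [upperWeight, e, div_pow, div_pow, show a + b + 2 = a + (b + 2) by ring, pow_add _ a (b + 2)]
  ring

lemma div_mem_Ioo {X Y M : ℕ} (hX : 1 ≤ X) (hY : 1 ≤ Y) (hXY : X + Y = M) :
    (Y / M : ℝ) ∈ Set.Ioo (0 : ℝ) 1 := by
  have hX' : (1 : ℝ) ≤ X := by exact_mod_cast hX
  have hY' : (1 : ℝ) ≤ Y := by exact_mod_cast hY
  have hM : (X : ℝ) + Y = M := by exact_mod_cast hXY
  have : (0 : ℝ) < M := by linarith
  exact ⟨by positivity, by rw [div_lt_one this]; linarith⟩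

/-- The comparison of weights for `b < a`, `a + b + 1 ≤ 200`. -/
lemma lowerWeight_le_of_lt {a b : ℕ} (hb : 1 ≤ b) (hab : b < a) (hn : a + b + 1 ≤ 200) {p q : ℝ}
    (hp : p ∈ Set.Ioo (0 : ℝ) 1) (hq : q ∈ Set.Ioo (0 : ℝ) 1)
    (hqp : upperTail (a + b + 1) a q = upperTail (a + b + 1) (a + 2) p)
    (hlow : 0.73 ≤ upperTail (a + b + 1) (a + 2) p) :
    lowerWeight a b p ≤ upperWeight a b q := by
  have ha : 1 ≤ a := by omega
  have htest := pairTest_of_rowTest (rowTest_eq_true hb (by omega)) hab (by omega)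
  simp only [pairTest, withValue_eq, Bool.and_eq_true, Bool.or_eq_true, Nat.ble_eq] at htest
  set X := 1000 * b - testShift b
  set M := 1000 * (a + b + 2) with hMdef
  set Y := M - X with hYdef
  set S := addTerms (a + b + 1) X Y b 0 (Nat.pow Y (a + b + 1)) 0 with hS
  obtain ⟨⟨⟨⟨hX, hY⟩, hXb⟩, hST⟩, htest⟩ := htest
  rw [Nat.pow_eq] at hST
  have hXY : X + Y = M := by omega
  have hM : 0 < M := by omega
  have hM' : (0 : ℝ) < M := by exact_mod_cast hM
  have hM'' : (M : ℝ) = 1000 * (a + b + 2) := by rw [hMdef]; push_cast; ring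
  have hXYr : (X : ℝ) + Y = M := by exact_mod_cast hXY
  have hp₁ := div_mem_Ioo hX hY hXY
  have htail : upperTail (a + b + 1) (a + 2) (Y / M : ℝ) = (S : ℝ) / M ^ (a + b + 1) := by
    have := upperTail_eq_addTerms (n := a + b + 1) (k := b) hX hY hXY (by omega)
    rwa [show a + b + 1 + 1 - b = a + 2 by omega] at this
  have hle : upperTail (a + b + 1) (a + 2) (Y / M : ℝ) ≤ upperTail (a + b + 1) (a + 2) p := by
    refine le_trans ?_ hlow
    have hST' := (Nat.cast_le (α := ℝ)).2 hST
    push_cast at hST'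
    rw [htail, div_le_iff₀ (by positivity)]
    linarith
  clear_value X S Y M
  rcases htest with htest | htest
  · simp only [ratioTest, Bool.and_eq_true, Nat.ble_eq] at htest
    obtain ⟨hturn, hratio⟩ := htest
    have hb0 : (0 : ℝ) < b := by exact_mod_cast hb
    have ha0 : (0 : ℝ) < a := by exact_mod_cast ha
    have hmode : ((a : ℝ) + 2) / (a + b + 2) ≤ Y / M := by
      have : (X : ℝ) ≤ 1000 * b := by exact_mod_cast hXb
      rw [div_le_div_iff₀ (by positivity) hM', hM'']
      rw [hM''] at hXYr
      nlinarith
    have hcrit := critical_mem_Ioo ha hb hmode hp₁.2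
    refine lowerWeight_le_of_logRatio_nonneg ha hb hp hq hqp (by norm_num at *; linarith)
      (le_of_upperTail_le (by omega) (by omega) hp₁ hp hle) hmode ?_ ?_
    · have : (X : ℝ) * ((b + 1) * (a + b)) ≤ b * b * M := by exact_mod_cast hturn
      have e : (Y : ℝ) / M = 1 - X / M := by rw [← hXYr] at hM' ⊢; field_simp; ring
      rw [turningPoint, e, sub_le_sub_iff_left, div_le_div_iff₀ hM' (by positivity)]
      linarith
    · rw [logRatio_nonneg_iff ha hb hmode hp₁.2]
      have hYM : M ≤ (b + 1) * Y := by
        have h0 := hcrit.1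
        rw [critical] at h0
        have h1 := (div_pos_iff_of_pos_right (by positivity : (0 : ℝ) < (a + 1) * b)).1 h0
        have h2 := (pos_iff_pos_of_mul_pos h1).1 ha0
        have h3 : (M : ℝ) < (b + 1) * Y := by
          rw [mul_div_assoc', sub_pos, lt_div_iff₀ hM'] at h2
          linarith
        exact_mod_cast h3.le
      have hc : critical a b (Y / M : ℝ) =
          ((a * ((b + 1) * Y - M) : ℕ) : ℝ) / (((a + 1) * b * M : ℕ) : ℝ) := by
        rw [critical]
        push_cast [Nat.cast_sub hYM]
        field_simp
      have hsum : (b * M + a * (b + 1) * X) + a * ((b + 1) * Y - M) = (a + 1) * b * M := by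
        zify [hYM]
        rw [← hXY]; push_cast; ring
      have hD : 0 < (a + 1) * b * M := by positivity
      rw [hc, upperWeight_div hD hsum, lowerWeight_div hM hXY, div_le_div_iff₀ (by positivity)
        (by positivity)]
      have hratio' : ((b + 1 : ℝ) ^ 2 * (b * (a + 1)) ^ (a + b + 2) * Y ^ (a + 2) * X ^ b) ≤
          (a + 1) ^ 2 * a ^ a * (((b + 1) * Y - M : ℕ) : ℝ) ^ a *
            (b * M + a * (b + 1) * X) ^ (b + 2) := by
        exact_mod_cast hratio
      have hMn : (0 : ℝ) ≤ (M : ℝ) ^ (a + b + 2) := by positivity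
      have := mul_le_mul_of_nonneg_right hratio' hMn
      rw [Nat.cast_mul a]
      generalize (((b + 1) * Y - M : ℕ) : ℝ) = z at this ⊢
      push_cast
      rw [mul_pow _ (M : ℝ), mul_pow (a : ℝ)]
      rw [mul_comm (b : ℝ) (a + 1)] at this
      linarith
  · simp only [weightTest, withValue_eq, Bool.and_eq_true, Nat.ble_eq] at htest
    set X' := 1000 * (b + 2) - matchedShift a b
    set Y' := M - X' with hY'def
    obtain ⟨⟨⟨⟨hX', hY'⟩, hS64⟩, hSS⟩, hweight⟩ := htest
    have hXY' : X' + Y' = M := by omega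
    have htail' := upperTail_eq_addTerms (n := a + b + 1) (k := b + 2) hX' hY' hXY' (by omega)
    rw [show a + b + 1 + 1 - (b + 2) = a by omega] at htail'
    refine lowerWeight_le_of_test hb hab.le hp hq hqp hp₁ (div_mem_Ioo hX' hY' hXY') ?_ hle ?_ ?_
    · have : (64 : ℝ) * M ^ (a + b + 1) ≤ 100 * S := by exact_mod_cast hS64
      rw [htail, le_div_iff₀ (by positivity)]
      linarith
    · rw [htail, htail']
      gcongr
    · rw [lowerWeight_div hM hXY, upperWeight_div hM hXY']
      have : (b + 1 : ℝ) ^ 2 * Y ^ (a + 2) * X ^ b < (a + 1) ^ 2 * Y' ^ a * X' ^ (b + 2) := by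
        exact_mod_cast hweight
      gcongr

/-- Points where the tails at levels `a` and `a + 2` equal a common value at least `0.73`
have comparable weights. -/
lemma lowerWeight_le_upperWeight {a b : ℕ} (ha : 1 ≤ a) (hb : 1 ≤ b) (hn : a + b + 1 ≤ 200)
    {p q : ℝ} (hp : p ∈ Set.Ioo (0 : ℝ) 1) (hq : q ∈ Set.Ioo (0 : ℝ) 1)
    (hqp : upperTail (a + b + 1) a q = upperTail (a + b + 1) (a + 2) p)
    (hlow : 0.73 ≤ upperTail (a + b + 1) (a + 2) p) :
    lowerWeight a b p ≤ upperWeight a b q := by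
  rcases le_or_gt a b with hab | hab
  · exact lowerWeight_le_of_le ha hab hp hq hqp (le_trans (by norm_num) hlow)
  · exact lowerWeight_le_of_lt hb hab hn hp hq hqp hlow

lemma succ_mul_one_sub_mul_B_succ {n k : ℕ} (hk : k < n) (p : ℝ) :
    (k + 1) * (1 - p) * B n (k + 1) p = (n - k) * p * B n k p := by
  have h1 := congrArg (Nat.cast (R := ℝ)) (Nat.choose_succ_right_eq n k)
  push_cast [Nat.cast_sub hk.le] at h1
  have h2 : n - k = n - (k + 1) + 1 := by omega
  rw [B, B, h2, pow_succ, pow_succ]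
  linear_combination (1 - p) * p ^ k * p * (1 - p) ^ (n - (k + 1)) * h1

lemma excess_of_upperTail_succ {n i : ℕ} (hi : i ≤ n) {β q : ℝ} (h : upperTail n (i + 1) q = β) :
    excess n i β q = ((n + 1 - i) * q * B n i q - i * β) / (n + 1) := by
  have hN : (n : ℝ) + 1 ≠ 0 := by positivity
  rw [excess, upperTail_eq_add hi, h]
  field_simp
  ring

lemma excess_succ_of_upperTail {n k : ℕ} (hk : k < n) {β q : ℝ} (h : upperTail n k q = β) :
    excess n (k + 1) β q = ((k + 1) * (1 - q) * B n k q - (k + 1) * β) / (n + 1) := by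
  have hN : (n : ℝ) + 1 ≠ 0 := by positivity
  have h1 : upperTail n (k + 1) q = β - B n k q := by
    linarith [upperTail_eq_add hk.le q]
  have h2 := succ_mul_one_sub_mul_B_succ hk q
  rw [excess, h1]
  push_cast
  field_simp
  linear_combination h2

lemma weight_B_eq_lowerWeight (a b : ℕ) (p : ℝ) :
    (b + 1) * p * B (a + b + 1) (a + 1) p =
      (a + b + 1).choose (a + 1) / (b + 1) * lowerWeight a b p := by
  have : (b : ℝ) + 1 ≠ 0 := by positivity
  rw [B, lowerWeight, show a + b + 1 - (a + 1) = b by omega]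
  field_simp
  ring

lemma weight_B_eq_upperWeight (a b : ℕ) (p : ℝ) :
    (a + 1) * (1 - p) * B (a + b + 1) a p =
      (a + b + 1).choose (a + 1) / (b + 1) * upperWeight a b p := by
  have : (b : ℝ) + 1 ≠ 0 := by positivity
  have h1 := congrArg (Nat.cast (R := ℝ)) (Nat.choose_succ_right_eq (a + b + 1) a)
  rw [show a + b + 1 - a = b + 1 by omega] at h1
  push_cast at h1
  rw [B, upperWeight, show a + b + 1 - a = b + 1 by omega]
  field_simp
  linear_combination -(1 - p) ^ (b + 2) * p ^ a * h1

lemma exists_upperTail_eq {n k : ℕ} (hk1 : 1 ≤ k) (hkn : k ≤ n) {β : ℝ}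
    (hβ : β ∈ Set.Ioo (0 : ℝ) 1) : ∃ q ∈ Set.Ioo (0 : ℝ) 1, upperTail n k q = β := by
  obtain ⟨Q, hQ⟩ := exists_upperTail_inverse hk1 hkn
  exact ⟨Q β, (hQ β hβ).1, (hQ β hβ).2.1⟩

lemma strictMonoOn_excess {n i : ℕ} (hi1 : 1 ≤ i) (hin : i ≤ n) {β q : ℝ}
    (hq : q ∈ Set.Ioo (0 : ℝ) 1) (h : upperTail n i q = β) :
    StrictMonoOn (excess n i β) (Set.Icc q 1) := by
  refine strictMonoOn_of_deriv_pos (convex_Icc q 1) (continuous_excess hin β).continuousOn ?_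
  intro p hp
  rw [interior_Icc] at hp
  rw [(hasDerivAt_excess hin β p).deriv, sub_pos, ← h]
  exact strictMonoOn_upperTail hi1 hin ⟨hq.1.le, hq.2.le⟩ ⟨(hq.1.trans hp.1).le, hp.2.le⟩ hp.1

lemma strictAntiOn_excess {n i : ℕ} (hi1 : 1 ≤ i) (hin : i ≤ n) {β q : ℝ}
    (hq : q ∈ Set.Ioo (0 : ℝ) 1) (h : upperTail n i q = β) :
    StrictAntiOn (excess n i β) (Set.Icc 0 q) := by
  refine strictAntiOn_of_deriv_neg (convex_Icc 0 q) (continuous_excess hin β).continuousOn ?_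
  intro p hp
  rw [interior_Icc] at hp
  rw [(hasDerivAt_excess hin β p).deriv, sub_neg, ← h]
  exact strictMonoOn_upperTail hi1 hin ⟨hp.1.le, (hp.2.trans hq.2).le⟩ ⟨hq.1.le, hq.2.le⟩ hp.2

lemma lt_of_upperTail_lt {n k : ℕ} (hk1 : 1 ≤ k) (hkn : k ≤ n) {p q : ℝ}
    (hp : p ∈ Set.Icc (0 : ℝ) 1) (hq : q ∈ Set.Icc (0 : ℝ) 1)
    (h : upperTail n k p < upperTail n k q) : p < q :=
  ((strictMonoOn_upperTail hk1 hkn).lt_iff_lt hp hq).1 h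

lemma one_lt_of_near_one {k : ℕ} {p : ℝ} (hp1 : p < 1) (hp : (k + 1 : ℝ) / (k + 2) ≤ p) :
    1 < p ^ (k + 2) + (k + 2) * p ^ (k + 1) * (1 - p) +
      (k + 2) ^ 2 * p ^ (k + 1) * (1 - p) ^ 2 := by
  set D : ℝ → ℝ := fun p => p ^ (k + 2) + (k + 2) * p ^ (k + 1) * (1 - p) +
      (k + 2) ^ 2 * p ^ (k + 1) * (1 - p) ^ 2 with hD
  have hder (x : ℝ) : HasDerivAt D
      ((k + 2) * (k + 3) * x ^ k * (1 - x) * ((k + 2) * (1 - x) - 1)) x := by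
    have h0 : HasDerivAt (fun x : ℝ => 1 - x) (-1) x := by
      simpa using (hasDerivAt_id x).const_sub 1
    have h1 := (hasDerivAt_id x).pow (k + 1)
    have h2 := (hasDerivAt_id x).pow (k + 2)
    have h := (h2.add ((h1.const_mul ((k : ℝ) + 2)).mul h0)).add
      ((h1.const_mul (((k : ℝ) + 2) ^ 2)).mul (h0.pow 2))
    refine (h.congr_deriv ?_).congr_of_eventuallyEq (Filter.Eventually.of_forall fun y => ?_)
    · simp only [id, Pi.pow_apply, Nat.add_sub_cancel, show k + 2 - 1 = k + 1 by omega]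
      push_cast
      ring
    · simp [hD]
  have hanti : StrictAntiOn D (Set.Icc p 1) := by
    refine strictAntiOn_of_deriv_neg (convex_Icc p 1)
      (fun x _ => (hder x).continuousAt.continuousWithinAt) fun x hx => ?_
    rw [interior_Icc] at hx
    have hp0 : 0 < p := lt_of_lt_of_le (by positivity) hp
    have hx0 : 0 < x := hp0.trans hx.1
    have h1 : 0 < 1 - x := by linarith [hx.2]
    have h2 : (k + 1 : ℝ) < x * (k + 2) := by
      rw [← div_lt_iff₀ (by positivity)]; exact hp.trans_lt hx.1
    rw [(hder x).deriv]
    exact mul_neg_of_pos_of_neg (by positivity) (by linarith)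
  have := hanti ⟨le_rfl, hp1.le⟩ ⟨hp1.le, le_rfl⟩ hp1
  simpa [hD] using this

lemma one_sub_lt_of_near_top {k : ℕ} {p : ℝ} (hp0 : 0 < p) (hp1 : p < 1)
    (h : 0.73 < p ^ (k + 2) + (k + 2) * p ^ (k + 1) * (1 - p)) :
    1 - (p ^ (k + 2) + (k + 2) * p ^ (k + 1) * (1 - p)) <
      (k + 2) ^ 2 * p ^ (k + 1) * (1 - p) ^ 2 := by
  rcases le_or_gt ((k + 1 : ℝ) / (k + 2)) p with hp | hp
  · linarith [one_lt_of_near_one hp1 hp]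
  · rw [lt_div_iff₀ (by positivity)] at hp
    have hw : 0 < p ^ (k + 1) := by positivity
    set μ := ((k : ℝ) + 2) * (1 - p) with hμ
    have hμ1 : 1 < μ := by rw [hμ]; linarith
    have e1 : p ^ (k + 2) + (k + 2) * p ^ (k + 1) * (1 - p) = p ^ (k + 1) * (p + μ) := by
      rw [hμ]; ring
    have e2 : (k + 2 : ℝ) ^ 2 * p ^ (k + 1) * (1 - p) ^ 2 = p ^ (k + 1) * μ ^ 2 := by
      rw [hμ]; ring
    rw [e1] at h ⊢
    rw [e2]
    have : p ^ (k + 1) * (p + μ) ≤ p ^ (k + 1) * (2 * μ ^ 2) := by gcongr; nlinarith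
    nlinarith

lemma cubic_le_one_add_pow (m : ℕ) {x : ℝ} (hx : 0 ≤ x) :
    1 + m * x + m * (m - 1) / 2 * x ^ 2 + m * (m - 1) * (m - 2) / 6 * x ^ 3 ≤ (1 + x) ^ m := by
  induction m with
  | zero => simp
  | succ m ih =>
    have hm : (0 : ℝ) ≤ m * (m - 1) * (m - 2) := by
      rcases m with - | - | m
      · simp
      · simp
      · push_cast
        have : (0 : ℝ) ≤ m := m.cast_nonneg
        have : (0 : ℝ) ≤ (m + 1 + 1) * (m + 1) * m := by positivity
        linarith
    have := mul_le_mul_of_nonneg_right ih (by linarith : 0 ≤ 1 + x)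
    rw [pow_succ]
    refine le_trans ?_ this
    have : 0 ≤ m * (m - 1) * (m - 2) / 6 * x ^ 4 := by positivity
    push_cast
    linarith

lemma sq_mul_pow_le {m : ℕ} (hm : 1 ≤ m) {q : ℝ} (hq0 : 0 < q) (hq1 : q < 1) :
    ((m : ℝ) + 1) ^ 2 * q ^ 2 * (1 - q) ^ m ≤ 0.73 := by
  have hm' : (1 : ℝ) ≤ m := by exact_mod_cast hm
  have hs : q * (m + 2) / 2 ≤ Real.exp (q * (m + 2) / 2 - 1) := by
    linarith [Real.add_one_le_exp (q * (m + 2) / 2 - 1)]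
  have ht : (1 - q) * (1 + 2 / m) ≤ Real.exp ((1 - q) * (1 + 2 / m) - 1) := by
    linarith [Real.add_one_le_exp ((1 - q) * (1 + 2 / m) - 1)]
  have hq' : 0 < 1 - q := by linarith
  have hst : (q * (m + 2) / 2) ^ 2 * ((1 - q) * (1 + 2 / m)) ^ m ≤ 1 := by
    calc _ ≤ Real.exp (q * (m + 2) / 2 - 1) ^ 2 * Real.exp ((1 - q) * (1 + 2 / m) - 1) ^ m := by
          gcongr
      _ = 1 := by
          rw [← Real.exp_nat_mul, ← Real.exp_nat_mul, ← Real.exp_add, Real.exp_eq_one_iff]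
          have : (m : ℝ) ≠ 0 := by positivity
          push_cast
          field_simp
          ring
  have hc := cubic_le_one_add_pow m (x := 2 / m) (by positivity)
  have hpoly : 4 * ((m : ℝ) + 1) ^ 2 ≤ 0.73 * (m + 2) ^ 2 * (1 + 2 / m) ^ m := by
    refine le_trans ?_ (mul_le_mul_of_nonneg_left hc (by positivity))
    have e : 1 + m * (2 / (m : ℝ)) + m * (m - 1) / 2 * (2 / m) ^ 2 +
        m * (m - 1) * (m - 2) / 6 * (2 / m) ^ 3 = (19 * m ^ 2 - 18 * m + 8) / (3 * m ^ 2) := by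
      field_simp
      ring
    rw [e, mul_div_assoc', le_div_iff₀ (by positivity)]
    nlinarith [sq_nonneg ((m : ℝ) - 1), pow_pos (by linarith : (0 : ℝ) < m) 3,
      mul_nonneg (by linarith : (0 : ℝ) ≤ m - 1) (sq_nonneg (m : ℝ)), sq_nonneg ((m : ℝ) ^ 2)]
  rw [mul_pow (1 - q)] at hst
  have hw : 0 ≤ q ^ 2 * (1 - q) ^ m := by positivity
  have h1 := mul_le_mul_of_nonneg_right hpoly hw
  nlinarith

lemma excess_top_lt {k : ℕ} {β q : ℝ} (hβ : 0.73 < β) (hq : q ∈ Set.Ioo (0 : ℝ) 1)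
    (h : upperTail (k + 2) (k + 1) q = β) :
    excess (k + 2) (k + 2) β 1 < excess (k + 2) (k + 2) β q := by
  have hB : B (k + 2) (k + 1) q = (k + 2) * q ^ (k + 1) * (1 - q) := by
    rw [B, show k + 2 - (k + 1) = 1 by omega, show k + 2 = (k + 1) + 1 by ring,
      Nat.choose_succ_self_right]
    push_cast
    ring
  have hB' : B (k + 2) (k + 2) q = q ^ (k + 2) := by simp [B]
  have hβ' : q ^ (k + 2) + (k + 2) * q ^ (k + 1) * (1 - q) = β := by
    rw [← h, upperTail_eq_add (by omega), hB, upperTail, show k + 1 + 1 = k + 2 by ring,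
      Finset.Icc_self, Finset.sum_singleton, hB']
    ring
  have hlt := one_sub_lt_of_near_top hq.1 hq.2 (hβ' ▸ hβ)
  rw [hβ'] at hlt
  have h1 : excess (k + 2) (k + 2) β 1 = (1 - (k + 3) * β) / ((k + 2 : ℕ) + 1) := by
    rw [excess, upperTail_one le_rfl]
    have : ((k + 2 : ℕ) : ℝ) + 1 ≠ 0 := by positivity
    field_simp
    push_cast
    ring
  rw [h1, excess_succ_of_upperTail (by omega) h, hB]
  refine div_lt_div_of_pos_right ?_ (by positivity)
  push_cast
  linarith

lemma excess_lt_excess {n k : ℕ} (hk : 1 ≤ k) (hkn : k + 1 ≤ n) (hn : n ≤ 200) {β q v : ℝ}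
    (hβ : 0.73 < β) (hβ1 : β < 1) (hq : q ∈ Set.Ioo (0 : ℝ) 1) (h : upperTail n k q = β)
    (hv : v ∈ Set.Ioc (0 : ℝ) 1) (hgt : β < upperTail n (k + 1) v)
    (hlt : k + 1 < n → upperTail n (k + 2) v < β) (htop : k + 1 = n → v = 1) :
    excess n (k + 1) β v < excess n (k + 1) β q := by
  rcases hkn.eq_or_lt with hkn | hkn
  · rw [htop hkn]
    obtain ⟨k, rfl⟩ := Nat.exists_eq_add_of_le' hk
    obtain rfl := hkn
    exact excess_top_lt hβ hq h
  · have hβ' : β ∈ Set.Ioo (0 : ℝ) 1 := ⟨by linarith, hβ1⟩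
    obtain ⟨q₁, hq₁, h₁⟩ := exists_upperTail_eq (n := n) (k := k + 1) (by omega) hkn.le hβ'
    obtain ⟨q₂, hq₂, h₂⟩ := exists_upperTail_eq (n := n) (k := k + 2) (by omega) hkn hβ'
    have hv' : v ∈ Set.Icc (0 : ℝ) 1 := ⟨hv.1.le, hv.2⟩
    have h1v := lt_of_upperTail_lt (by omega) hkn.le (Set.Ioo_subset_Icc_self hq₁) hv'
      (h₁.trans_lt hgt)
    have hv2 := lt_of_upperTail_lt (by omega) hkn hv' (Set.Ioo_subset_Icc_self hq₂)
      ((hlt hkn).trans_eq h₂.symm)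
    refine (strictMonoOn_excess (by omega) hkn.le hq₁ h₁ ⟨h1v.le, hv.2⟩
      ⟨(h1v.trans hv2).le, hq₂.2.le⟩ hv2).trans_le ?_
    obtain ⟨b, rfl⟩ := Nat.exists_eq_add_of_le hkn.le
    obtain ⟨b, rfl⟩ := Nat.exists_eq_add_of_le' (show 1 ≤ b by omega)
    rw [show k + 1 + (b + 1) = k + (b + 1) + 1 by ring] at *
    have hw := lowerWeight_le_upperWeight hk (by omega : 1 ≤ b + 1) hn hq₂ hq (h.trans h₂.symm)
      (h₂.symm ▸ hβ.le)
    rw [excess_of_upperTail_succ (by omega) h₂, excess_succ_of_upperTail (by omega) h]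
    refine div_le_div_of_nonneg_right ?_ (by positivity)
    have e : ((k + (b + 1) + 1 : ℕ) : ℝ) + 1 - (k + 1 : ℕ) = ((b + 1 : ℕ) : ℝ) + 1 := by
      push_cast; ring
    rw [e, weight_B_eq_lowerWeight, weight_B_eq_upperWeight]
    push_cast
    have := mul_le_mul_of_nonneg_left hw
      (by positivity : (0 : ℝ) ≤ (k + (b + 1) + 1).choose (k + 1) / ((b + 1 : ℕ) + 1))
    push_cast at this
    linarith

lemma tails_of_excess_eq {n k : ℕ} (hk : 1 ≤ k) (hkn : k + 1 ≤ n) (hn : n ≤ 200) {β v w : ℝ}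
    (hβ : 0.73 < β) (hβ1 : β < 1) (hw : 0 < w) (hwv : w < v) (hv : v ≤ 1)
    (heq : excess n (k + 1) β v = excess n (k + 1) β w) (hgt : β < upperTail n (k + 1) v)
    (hlt : k + 1 < n → upperTail n (k + 2) v < β) (htop : k + 1 = n → v = 1) :
    β < upperTail n k w ∧ upperTail n (k + 1) w < β := by
  have hβ' : β ∈ Set.Ioo (0 : ℝ) 1 := ⟨by linarith, hβ1⟩
  obtain ⟨q₀, hq₀, h₀⟩ := exists_upperTail_eq (n := n) hk (by omega) hβ'
  obtain ⟨q₁, hq₁, h₁⟩ := exists_upperTail_eq (n := n) (k := k + 1) (by omega) hkn hβ'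
  have hw' : w ∈ Set.Icc (0 : ℝ) 1 := ⟨hw.le, hwv.le.trans hv⟩
  have hwq : w < q₁ := by
    by_contra! hle
    exact (strictMonoOn_excess (by omega) hkn hq₁ h₁ ⟨hle, hw'.2⟩ ⟨hle.trans hwv.le, hv⟩
      hwv).ne' heq
  refine ⟨?_, h₁ ▸ strictMonoOn_upperTail (by omega) hkn hw' (Set.Ioo_subset_Icc_self hq₁) hwq⟩
  by_contra! hle
  have hq01 : q₀ ≤ q₁ := by
    refine le_of_upperTail_le hk (show k ≤ n by omega) hq₀ hq₁ ?_
    rw [h₀, ← h₁, upperTail_eq_add (show k ≤ n by omega)]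
    linarith [B_nonneg n k hq₁.1.le hq₁.2.le]
  have hwq0 : w ≤ q₀ :=
    ((strictMonoOn_upperTail hk (by omega)).le_iff_le hw' (Set.Ioo_subset_Icc_self hq₀)).1
      (hle.trans_eq h₀.symm)
  have h2 := (strictAntiOn_excess (by omega) hkn hq₁ h₁).antitoneOn ⟨hw.le, hwq.le⟩
    ⟨hq₀.1.le, hq01⟩ hwq0
  have h3 := excess_lt_excess hk hkn hn hβ hβ1 hq₀ h₀ ⟨hw.trans hwv, hv⟩ hgt hlt htop
  linarith

lemma excess_neg {n j : ℕ} (hj : 1 ≤ j) (hjn : j ≤ n) (hn : n ≤ 200) {β v : ℝ}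
    (hβ : 0.73 < β) (hβ1 : β < 1) (hv : v ∈ Set.Ioc (0 : ℝ) 1) (hgt : β < upperTail n j v)
    (hlt : j < n → upperTail n (j + 1) v < β) (htop : j = n → v = 1) :
    excess n j β v < 0 := by
  have hβ' : β ∈ Set.Ioo (0 : ℝ) 1 := ⟨by linarith, hβ1⟩
  obtain ⟨k, rfl⟩ := Nat.exists_eq_add_of_le' hj
  rcases k.eq_zero_or_pos with rfl | hk
  · simp only [zero_add] at *
    rcases hjn.eq_or_lt with hn1 | hn1
    · rw [htop hn1, ← hn1, excess, upperTail_one le_rfl]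
      norm_num
      linarith
    · obtain ⟨q₁, hq₁, h₁⟩ := exists_upperTail_eq (n := n) (k := 1) le_rfl hjn hβ'
      obtain ⟨q₂, hq₂, h₂⟩ := exists_upperTail_eq (n := n) (k := 1 + 1) (by omega) hn1 hβ'
      have hv' : v ∈ Set.Icc (0 : ℝ) 1 := ⟨hv.1.le, hv.2⟩
      have h1v := lt_of_upperTail_lt le_rfl hjn (Set.Ioo_subset_Icc_self hq₁) hv'
        (h₁.trans_lt hgt)
      have hv2 := lt_of_upperTail_lt (by omega) hn1 hv' (Set.Ioo_subset_Icc_self hq₂)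
        ((hlt hn1).trans_eq h₂.symm)
      refine (strictMonoOn_excess le_rfl hjn hq₁ h₁ ⟨h1v.le, hv.2⟩
        ⟨(h1v.trans hv2).le, hq₂.2.le⟩ hv2).trans ?_
      obtain ⟨m, rfl⟩ := Nat.exists_eq_add_of_le' hjn
      have hs := sq_mul_pow_le (show 1 ≤ m by omega) hq₂.1 hq₂.2
      rw [excess_of_upperTail_succ hjn h₂, B]
      refine div_neg_of_neg_of_pos ?_ (by positivity)
      simp only [Nat.choose_one_right, Nat.add_sub_cancel]
      push_cast
      linarith
  · obtain ⟨q, hq, h⟩ := exists_upperTail_eq (n := n) hk (by omega) hβ'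
    refine (excess_lt_excess hk hjn hn hβ hβ1 hq h hv hgt hlt htop).trans_le ?_
    rw [excess_succ_of_upperTail (by omega) h]
    refine div_nonpos_of_nonpos_of_nonneg ?_ (by positivity)
    have hB : B n k q ≤ β := by
      rw [← h, upperTail_eq_add (by omega)]
      linarith [upperTail_nonneg n (k + 1) hq.1.le hq.2.le]
    have hB0 := B_nonneg n k hq.1.le hq.2.le
    have : (1 - q) * B n k q ≤ β := by nlinarith [hq.1]
    nlinarith [k.cast_nonneg (α := ℝ)]

theorem stmt_0 (n : ℕ) (hn1 : 1 ≤ n) (hn2 : n ≤ 200)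
    (α : ℝ) (hα1 : (0.0001 : ℝ) < α) (hα2 : α < 0.27)
    (j : ℕ) (hj1 : 1 ≤ j) (hj2 : j ≤ n)
    (u : ℕ → ℝ)
    (hmem : ∀ i, j ≤ i → i ≤ n → 0 < u i ∧ u i ≤ 1)
    (hmono : ∀ i, j ≤ i → i < n → u i < u (i + 1))
    (hun : u n = 1)
    (heq : ∀ i, j + 1 ≤ i → i ≤ n →
      ∫ p in (u (i - 1))..(u i), ∑ x ∈ Finset.Icc i n, B n x p
        = (1 - α) * (u i - u (i - 1))) :
    ∃! a : ℝ, 0 < a ∧ a < u j ∧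
      (∫ p in a..(u j), ∑ x ∈ Finset.Icc j n, B n x p) = (1 - α) * (u j - a) := by
  generalize hβ : 1 - α = β at heq ⊢
  have hβ73 : 0.73 < β := by linarith
  have hβ1 : β < 1 := by linarith
  have hint {i : ℕ} (hi : i ≤ n) (s t : ℝ) :
      (∫ p in s..t, ∑ x ∈ Finset.Icc i n, B n x p) = β * (t - s) ↔
        excess n i β t = excess n i β s := by
    rw [← sub_eq_zero, integral_upperTail hi, sub_eq_zero]
  have htails (i : ℕ) (hij : j ≤ i) (hin : i ≤ n) :
      β < upperTail n i (u i) ∧ (i < n → upperTail n (i + 1) (u i) < β) := by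
    induction hin using Nat.decreasingInduction with
    | self => rw [hun, upperTail_one le_rfl]; exact ⟨hβ1, fun h => absurd h (lt_irrefl n)⟩
    | of_succ k hk ih =>
      obtain ⟨hgt, hlt⟩ := ih (by omega)
      have he := (hint hk _ _).1 (heq (k + 1) (by omega) hk)
      have := tails_of_excess_eq (by omega) hk hn2 hβ73 hβ1 (hmem k hij hk.le).1 (hmono k hij hk)
        (hmem (k + 1) (by omega) hk).2 he hgt hlt (fun h => h ▸ hun)
      exact ⟨this.1, fun _ => this.2⟩
  obtain ⟨hgt, hlt⟩ := htails j le_rfl hj2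
  have hu := hmem j le_rfl hj2
  have hneg := excess_neg hj1 hj2 hn2 hβ73 hβ1 hu hgt hlt (fun h => h ▸ hun)
  obtain ⟨q, hq, h⟩ := exists_upperTail_eq hj1 hj2 ⟨by linarith, hβ1⟩
  have hqu := lt_of_upperTail_lt hj1 hj2 (Set.Ioo_subset_Icc_self hq) ⟨hu.1.le, hu.2⟩
    (h.trans_lt hgt)
  have hanti := strictAntiOn_excess hj1 hj2 hq h
  have hmon := strictMonoOn_excess hj1 hj2 hq h
  have hqlt := hmon ⟨le_rfl, hq.2.le⟩ ⟨hqu.le, hu.2⟩ hqu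
  obtain ⟨a, ha, hau⟩ := intermediate_value_Ioo' hq.1.le (continuous_excess hj2 β).continuousOn
    ⟨hqlt, by rwa [excess_zero hj1]⟩
  refine ⟨a, ⟨ha.1, ha.2.trans hqu, (hint hj2 _ _).2 hau.symm⟩, fun a' ⟨h0, h1, he⟩ => ?_⟩
  have he := (hint hj2 _ _).1 he
  have ha' : a' ≤ q := by
    by_contra! hlt
    exact (hmon ⟨hlt.le, h1.le.trans hu.2⟩ ⟨hqu.le, hu.2⟩ h1).ne' he
  exact hanti.injOn ⟨h0.le, ha'⟩ ⟨ha.1.le, ha.2.le⟩ (he.symm.trans hau.symm)
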